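/- arXiv:1609.02468 — 6 statements merged into one kernel-verified Lean document; each statement's English description precedes it below -/
import Mathlib

section
/- There exists a time T > 0, depending only on K, the supremum norms of ω₀ and ρ₀ and of their first derivatives, such that there exists exactly one pair of bounded continuous functions ω : ℝ² × [0,T] → ℝ and Φ : ℝ × [0,T] → ℝ satisfying, for all z = (z₁,z₂) ∈ ℝ² and t ∈ [0,T]: ω(z₁,z₂,t) = ω₀(z₁, z₂ − Φ(z₁,t)) + f₁(z₁, z₂ − Φ(z₁,t)) · ∫₀ᵗ e^{Φ(z₁,s)/2} ds, and Φ(z₁,t) = (1/2) ∫₀ᵗ ∫_{z₁}^{∞} ∫_{ℝ} ω(z̃₁,z₂,s)/cosh(z₂) dz₂ dz̃₁ ds. -/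
open MeasureTheory Real

/-- `IsSolution T ω₀ ρ₀ ω Φ` says that `(ω, Φ)` is a bounded continuous pair solving,
on `ℝ² × [0,T]`, the integral form of the hyperbolic Boussinesq system in the
`z`-coordinates:
`ω(z,t) = ω₀(z₁, z₂ - Φ(z₁,t)) + f₁(z₁, z₂ - Φ(z₁,t)) ∫₀ᵗ e^{Φ(z₁,s)/2} ds`,
`Φ(z₁,t) = (1/2) ∫₀ᵗ ∫_{z₁}^∞ ∫_ℝ ω(z̃₁,z₂,s)/cosh(z₂) dz₂ dz̃₁ ds`,
with `f₁(z₁,z₂) = e^{(z₂-z₁)/2} ρ₀(z₁,z₂)`. -/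
def IsSolution (T : ℝ) (ω₀ ρ₀ : ℝ × ℝ → ℝ) (ω : ℝ × ℝ → ℝ → ℝ)
    (Φ : ℝ → ℝ → ℝ) : Prop :=
  (∃ M, ∀ z : ℝ × ℝ, ∀ t ∈ Set.Icc (0:ℝ) T, |ω z t| ≤ M) ∧
  (∃ M, ∀ z₁ : ℝ, ∀ t ∈ Set.Icc (0:ℝ) T, |Φ z₁ t| ≤ M) ∧
  ContinuousOn (fun p : (ℝ × ℝ) × ℝ => ω p.1 p.2) (Set.univ ×ˢ Set.Icc (0:ℝ) T) ∧
  ContinuousOn (fun p : ℝ × ℝ => Φ p.1 p.2) (Set.univ ×ˢ Set.Icc (0:ℝ) T) ∧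
  (∀ z : ℝ × ℝ, ∀ t ∈ Set.Icc (0:ℝ) T,
    ω z t = ω₀ (z.1, z.2 - Φ z.1 t) +
      Real.exp ((z.2 - Φ z.1 t - z.1) / 2) * ρ₀ (z.1, z.2 - Φ z.1 t) *
        ∫ s in (0:ℝ)..t, Real.exp (Φ z.1 s / 2)) ∧
  (∀ z₁ : ℝ, ∀ t ∈ Set.Icc (0:ℝ) T,
    Φ z₁ t = (1 / 2) * ∫ s in (0:ℝ)..t, ∫ w in Set.Ioi z₁, ∫ z₂ : ℝ,
      ω (w, z₂) s / Real.cosh z₂)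

namespace Boussinesq

open Set
open scoped BoundedContinuousFunction

theorem inv_cosh_add_le (a b : ℝ) : (cosh (a + b))⁻¹ ≤ 2 * exp |b| * exp (-|a|) := by
  have h1 : exp (|a| - |b|) ≤ 2 * cosh (a + b) := by
    have h2 : |a| - |b| ≤ |a + b| := by
      have := abs_sub_abs_le_abs_sub a (-b)
      rwa [abs_neg, sub_neg_eq_add] at this
    have h3 : exp |a + b| ≤ 2 * cosh (a + b) := by
      have := exp_abs_le (a + b)
      rw [cosh_eq]
      linarith
    exact (exp_le_exp.2 h2).trans h3
  rw [inv_le_iff_one_le_mul₀ (cosh_pos _)]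
  have h4 : exp |b| * exp (-|a|) * exp (|a| - |b|) = 1 := by
    rw [← exp_add, ← exp_add, ← exp_zero]
    congr 1
    ring
  have h5 : 0 < exp |b| * exp (-|a|) := by positivity
  nlinarith [mul_le_mul_of_nonneg_left h1 h5.le]

theorem inv_cosh_shift_le {K R w v φ : ℝ} (hv : |v| ≤ K) (hφ : |φ| ≤ R) :
    (cosh (w + v + φ))⁻¹ ≤ 2 * exp (K + R) * exp (-|w|) := by
  rw [add_assoc]
  refine (inv_cosh_add_le w (v + φ)).trans ?_
  have : |v + φ| ≤ K + R := (abs_add_le v φ).trans (add_le_add hv hφ)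
  gcongr

theorem abs_inv_cosh_shift_sub_le {K R w v φ φ' : ℝ} (hv : |v| ≤ K) (hφ : |φ| ≤ R)
    (hφ' : |φ'| ≤ R) :
    |(cosh (w + v + φ))⁻¹ - (cosh (w + v + φ'))⁻¹| ≤
      2 * exp (K + R) * exp (-|w|) * |φ - φ'| := by
  have hderiv : ∀ x ∈ Icc (-R) R, HasDerivWithinAt (fun x => (cosh (w + v + x))⁻¹)
      (-(sinh (w + v + x) * 1) / cosh (w + v + x) ^ 2) (Icc (-R) R) x := fun x _ =>
    ((((hasDerivAt_id x).const_add (w + v)).cosh).inv (cosh_pos _).ne').hasDerivWithinAt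
  have hbound : ∀ x ∈ Icc (-R) R, ‖-(sinh (w + v + x) * 1) / cosh (w + v + x) ^ 2‖ ≤
      2 * exp (K + R) * exp (-|w|) := by
    intro x hx
    refine le_trans ?_ (inv_cosh_shift_le (w := w) hv (abs_le.2 hx))
    have hc := cosh_pos (w + v + x)
    have hs : |sinh (w + v + x)| ≤ cosh (w + v + x) :=
      abs_le_of_sq_le_sq (by nlinarith [cosh_sq (w + v + x)]) hc.le
    rw [norm_div, norm_neg, mul_one, norm_pow, Real.norm_eq_abs, Real.norm_eq_abs,
      abs_of_pos hc, div_le_iff₀ (by positivity), sq, inv_mul_cancel_left₀ hc.ne']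
    exact hs
  simpa using (convex_Icc (-R) R).norm_image_sub_le_of_norm_hasDerivWithin_le hderiv hbound
    (abs_le.1 hφ') (abs_le.1 hφ)

theorem abs_exp_half_sub_le {R x y : ℝ} (hx : |x| ≤ R) (hy : |y| ≤ R) :
    |exp (x / 2) - exp (y / 2)| ≤ exp (R / 2) * |x - y| := by
  have hderiv : ∀ r ∈ Icc (-R) R, HasDerivWithinAt (fun r => exp (r / 2))
      (exp (r / 2) * (1 / 2)) (Icc (-R) R) r := fun r _ =>
    (((hasDerivAt_id r).div_const 2).exp).hasDerivWithinAt
  have hbound : ∀ r ∈ Icc (-R) R, ‖exp (r / 2) * (1 / 2)‖ ≤ exp (R / 2) := by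
    intro r hr
    rw [Real.norm_eq_abs, abs_of_pos (by positivity)]
    have : exp (r / 2) ≤ exp (R / 2) := exp_le_exp.2 (by linarith [hr.2])
    linarith [exp_pos (r / 2)]
  simpa using (convex_Icc (-R) R).norm_image_sub_le_of_norm_hasDerivWithin_le hderiv hbound
    (abs_le.1 hy) (abs_le.1 hx)

theorem integrable_exp_neg_abs : Integrable (fun w : ℝ => exp (-|w|)) := by
  rw [← integrableOn_univ, ← Iic_union_Ioi (a := (0 : ℝ)), integrableOn_union]
  refine ⟨(integrableOn_exp_Iic 0).congr_fun (fun w hw => ?_) measurableSet_Iic,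
    (integrableOn_exp_neg_Ioi 0).congr_fun (fun w hw => ?_) measurableSet_Ioi⟩
  · simp only [abs_of_nonpos (mem_Iic.1 hw), neg_neg]
  · simp only [abs_of_pos (mem_Ioi.1 hw)]

theorem continuous_integral_Ioi {g : ℝ → ℝ} (hg : Integrable g) :
    Continuous fun z => ∫ w in Ioi z, g w := by
  have : (fun z => ∫ w in Ioi z, g w) = fun z => (∫ w in Ioi 0, g w) - ∫ w in (0 : ℝ)..z, g w := by
    funext z
    rw [← intervalIntegral.integral_Ioi_sub_Ioi' hg.integrableOn hg.integrableOn, sub_sub_cancel]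
  rw [this]
  exact continuous_const.sub
    (intervalIntegral.continuous_primitive (fun a b => hg.intervalIntegrable) 0)

/-- The data: continuous, bounded by `A` and `B`, and supported in the strip `|z₁ - z₂| ≤ K`. -/
structure IsDatum (K A B : ℝ) (ω₀ ρ₀ : ℝ × ℝ → ℝ) : Prop where
  continuous_vorticity : Continuous ω₀
  continuous_density : Continuous ρ₀
  vorticity_le : ∀ z, |ω₀ z| ≤ A
  density_le : ∀ z, |ρ₀ z| ≤ B
  vorticity_support : ∀ z, ω₀ z ≠ 0 → |z.1 - z.2| ≤ K
  density_support : ∀ z, ρ₀ z ≠ 0 → |z.1 - z.2| ≤ K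

/-- The vorticity with source accumulated by the factor `e`, in the Lagrangian label
`(w, w + v)`. -/
noncomputable def profile (ω₀ ρ₀ : ℝ × ℝ → ℝ) (w e v : ℝ) : ℝ :=
  ω₀ (w, w + v) + exp (v / 2) * ρ₀ (w, w + v) * e

/-- The integral of the transported vorticity against `1 / cosh` along the line `z₁ = w`. -/
noncomputable def slice (K : ℝ) (ω₀ ρ₀ : ℝ × ℝ → ℝ) (w φ e : ℝ) : ℝ :=
  ∫ v in -K..K, profile ω₀ ρ₀ w e v * (cosh (w + v + φ))⁻¹

/-- The decay constant of `slice` on `|φ|, |e| ≤ R`. -/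
noncomputable def sliceBound (K A B R : ℝ) : ℝ :=
  (A + exp (K / 2) * B * R) * (2 * exp (K + R)) * (2 * K)

/-- The Lipschitz constant of `slice` on `|φ|, |e| ≤ R`. -/
noncomputable def sliceLip (K A B R : ℝ) : ℝ :=
  (A + exp (K / 2) * B * R + exp (K / 2) * B) * (2 * exp (K + R)) * (2 * K)

variable {K A B : ℝ} {ω₀ ρ₀ : ℝ × ℝ → ℝ}

namespace IsDatum

theorem nonneg_left (h : IsDatum K A B ω₀ ρ₀) : 0 ≤ A := (abs_nonneg _).trans (h.vorticity_le 0)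

theorem nonneg_right (h : IsDatum K A B ω₀ ρ₀) : 0 ≤ B := (abs_nonneg _).trans (h.density_le 0)

theorem profile_eq_zero (h : IsDatum K A B ω₀ ρ₀) {w e v : ℝ} (hv : K < |v|) :
    profile ω₀ ρ₀ w e v = 0 := by
  have key : ∀ g : ℝ × ℝ → ℝ, (∀ z, g z ≠ 0 → |z.1 - z.2| ≤ K) → g (w, w + v) = 0 := by
    intro g hg
    by_contra hne
    have := hg _ hne
    simp only [sub_add_cancel_left, abs_neg] at this
    exact this.not_gt hv
  simp [profile, key _ h.vorticity_support, key _ h.density_support]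

theorem abs_source_le (h : IsDatum K A B ω₀ ρ₀) {w v : ℝ} (hv : |v| ≤ K) :
    |exp (v / 2) * ρ₀ (w, w + v)| ≤ exp (K / 2) * B := by
  rw [abs_mul, abs_of_pos (exp_pos _)]
  have h1 : exp (v / 2) ≤ exp (K / 2) := exp_le_exp.2 (by linarith [(abs_le.1 hv).2])
  exact mul_le_mul h1 (h.density_le _) (abs_nonneg _) (exp_pos _).le

theorem abs_profile_le (h : IsDatum K A B ω₀ ρ₀) {R w e : ℝ} (he : |e| ≤ R) (v : ℝ) :
    |profile ω₀ ρ₀ w e v| ≤ A + exp (K / 2) * B * R := by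
  have hB := h.nonneg_right
  rcases le_or_gt |v| K with hv | hv
  · refine (abs_add_le _ _).trans (add_le_add (h.vorticity_le _) ?_)
    rw [abs_mul]
    exact mul_le_mul (h.abs_source_le hv) he (abs_nonneg _) (by positivity)
  · rw [h.profile_eq_zero hv, abs_zero]
    have := h.nonneg_left
    have := (abs_nonneg e).trans he
    positivity

theorem continuous_profile (h : IsDatum K A B ω₀ ρ₀) :
    Continuous fun p : ℝ × ℝ × ℝ => profile ω₀ ρ₀ p.1 p.2.1 p.2.2 := by
  have := h.continuous_vorticity
  have := h.continuous_density
  unfold profile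
  fun_prop

theorem continuous_kernel (h : IsDatum K A B ω₀ ρ₀) :
    Continuous fun p : (ℝ × ℝ × ℝ) × ℝ =>
      profile ω₀ ρ₀ p.1.1 p.1.2.2 p.2 * (cosh (p.1.1 + p.2 + p.1.2.1))⁻¹ := by
  refine (h.continuous_profile.comp (f := fun p : (ℝ × ℝ × ℝ) × ℝ => (p.1.1, p.1.2.2, p.2))
    (by fun_prop)).mul (Continuous.inv₀ (by fun_prop) fun p => (cosh_pos _).ne')

theorem continuous_slice (h : IsDatum K A B ω₀ ρ₀) :
    Continuous fun p : ℝ × ℝ × ℝ => slice K ω₀ ρ₀ p.1 p.2.1 p.2.2 :=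
  intervalIntegral.continuous_parametric_intervalIntegral_of_continuous' h.continuous_kernel _ _

theorem integral_transported (h : IsDatum K A B ω₀ ρ₀) (hK : 0 ≤ K) (w φ e : ℝ) :
    ∫ z₂, (ω₀ (w, z₂ - φ) + exp ((z₂ - φ - w) / 2) * ρ₀ (w, z₂ - φ) * e) / cosh z₂ =
      slice K ω₀ ρ₀ w φ e := by
  rw [slice, intervalIntegral.integral_of_le (by linarith), ← integral_Icc_eq_integral_Ioc,
    setIntegral_eq_integral_of_forall_compl_eq_zero,
    ← integral_sub_right_eq_self (fun v => profile ω₀ ρ₀ w e v * (cosh (w + v + φ))⁻¹) (w + φ)]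
  · refine integral_congr_ae (Filter.Eventually.of_forall fun z => ?_)
    have h1 : w + (z - (w + φ)) = z - φ := by ring
    have h2 : (z - (w + φ)) / 2 = (z - φ - w) / 2 := by ring
    simp only [profile, h1, h2, sub_add_cancel, div_eq_mul_inv]
  · intro v hv
    rw [h.profile_eq_zero, zero_mul]
    by_contra hle
    exact hv (abs_le.1 (not_lt.1 hle))

theorem abs_slice_le (h : IsDatum K A B ω₀ ρ₀) (hK : 0 ≤ K) {R w φ e : ℝ} (hφ : |φ| ≤ R)
    (he : |e| ≤ R) : |slice K ω₀ ρ₀ w φ e| ≤ sliceBound K A B R * exp (-|w|) := by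
  have hR := (abs_nonneg _).trans hφ
  have := h.nonneg_left
  have := h.nonneg_right
  have key : ∀ v ∈ uIoc (-K) K, ‖profile ω₀ ρ₀ w e v * (cosh (w + v + φ))⁻¹‖ ≤
      (A + exp (K / 2) * B * R) * (2 * exp (K + R) * exp (-|w|)) := by
    intro v hv
    rw [uIoc_of_le (by linarith)] at hv
    have hv' : |v| ≤ K := abs_le.2 ⟨hv.1.le, hv.2⟩
    rw [Real.norm_eq_abs, abs_mul, abs_of_pos (inv_pos.2 (cosh_pos (w + v + φ)))]
    exact mul_le_mul (h.abs_profile_le he v) (inv_cosh_shift_le hv' hφ)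
      (inv_pos.2 (cosh_pos _)).le (by positivity)
  refine (intervalIntegral.norm_integral_le_of_norm_le_const key).trans_eq ?_
  rw [abs_of_nonneg (show 0 ≤ K - -K by linarith), sliceBound]
  ring

theorem abs_slice_sub_le (h : IsDatum K A B ω₀ ρ₀) (hK : 0 ≤ K) {R δ w φ e φ' e' : ℝ}
    (hφ : |φ| ≤ R) (he : |e| ≤ R) (hφ' : |φ'| ≤ R) (hφδ : |φ - φ'| ≤ δ) (heδ : |e - e'| ≤ δ) :
    |slice K ω₀ ρ₀ w φ e - slice K ω₀ ρ₀ w φ' e'| ≤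
      sliceLip K A B R * exp (-|w|) * δ := by
  have hR := (abs_nonneg _).trans hφ
  have hδ := (abs_nonneg _).trans hφδ
  have := h.nonneg_left
  have := h.nonneg_right
  have hint : ∀ φ e, IntervalIntegrable
      (fun v => profile ω₀ ρ₀ w e v * (cosh (w + v + φ))⁻¹) volume (-K) K := fun φ e =>
    (h.continuous_kernel.comp
      (f := fun v => ((w, φ, e), v)) (by fun_prop)).intervalIntegrable _ _
  rw [slice, slice, ← intervalIntegral.integral_sub (hint φ e) (hint φ' e')]
  have key : ∀ v ∈ uIoc (-K) K, ‖profile ω₀ ρ₀ w e v * (cosh (w + v + φ))⁻¹ -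
      profile ω₀ ρ₀ w e' v * (cosh (w + v + φ'))⁻¹‖ ≤
      (A + exp (K / 2) * B * R + exp (K / 2) * B) * (2 * exp (K + R) * exp (-|w|) * δ) := by
    intro v hv
    rw [uIoc_of_le (by linarith)] at hv
    have hv' : |v| ≤ K := abs_le.2 ⟨hv.1.le, hv.2⟩
    have split : profile ω₀ ρ₀ w e v * (cosh (w + v + φ))⁻¹ -
        profile ω₀ ρ₀ w e' v * (cosh (w + v + φ'))⁻¹ =
        profile ω₀ ρ₀ w e v * ((cosh (w + v + φ))⁻¹ - (cosh (w + v + φ'))⁻¹) +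
        exp (v / 2) * ρ₀ (w, w + v) * ((e - e') * (cosh (w + v + φ'))⁻¹) := by
      simp only [profile]
      ring
    rw [split, add_mul]
    refine (norm_add_le _ _).trans (add_le_add ?_ ?_)
    · rw [norm_mul]
      refine mul_le_mul (h.abs_profile_le he v)
        ((abs_inv_cosh_shift_sub_le hv' hφ hφ').trans ?_) (norm_nonneg _) (by positivity)
      gcongr
    · rw [norm_mul]
      refine mul_le_mul (h.abs_source_le hv') ?_ (norm_nonneg _) (by positivity)
      rw [Real.norm_eq_abs, abs_mul, abs_of_pos (inv_pos.2 (cosh_pos (w + v + φ'))), mul_comm]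
      exact mul_le_mul (inv_cosh_shift_le hv' hφ') heδ (abs_nonneg _) (by positivity)
  refine (intervalIntegral.norm_integral_le_of_norm_le_const key).trans_eq ?_
  rw [abs_of_nonneg (show 0 ≤ K - -K by linarith), sliceLip]
  ring

end IsDatum

theorem integral_exp_neg_abs_nonneg : 0 ≤ ∫ w : ℝ, exp (-|w|) :=
  integral_nonneg fun w => (exp_pos (-|w|)).le

theorem abs_integral_Ioi_le {g : ℝ → ℝ} {c : ℝ} (hc : 0 ≤ c) (hg : ∀ w, |g w| ≤ c * exp (-|w|))
    (z : ℝ) : |∫ w in Ioi z, g w| ≤ c * ∫ w, exp (-|w|) := by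
  have hint : Integrable (fun w : ℝ => c * exp (-|w|)) := integrable_exp_neg_abs.const_mul c
  refine (norm_integral_le_of_norm_le (f := g) hint.integrableOn
    (Filter.Eventually.of_forall fun w => hg w)).trans ?_
  rw [← integral_const_mul]
  exact setIntegral_le_integral hint (Filter.Eventually.of_forall fun w => by positivity)

/-- Pairs of bounded continuous functions: the displacement `Φ(·, t)` and the stretching factor
`∫₀ᵗ e^{Φ(·, s)/2} ds`. -/
abbrev State : Type := (ℝ →ᵇ ℝ) × (ℝ →ᵇ ℝ)

theorem State.abs_fst_le (u : State) (z : ℝ) : |u.1 z| ≤ ‖u‖ :=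
  (u.1.norm_coe_le_norm z).trans (norm_fst_le u)

theorem State.abs_snd_le (u : State) (z : ℝ) : |u.2 z| ≤ ‖u‖ :=
  (u.2.norm_coe_le_norm z).trans (norm_snd_le u)

namespace IsDatum

theorem sliceBound_nonneg (h : IsDatum K A B ω₀ ρ₀) (hK : 0 ≤ K) {R : ℝ} (hR : 0 ≤ R) :
    0 ≤ sliceBound K A B R := by
  have := h.nonneg_left
  have := h.nonneg_right
  unfold sliceBound
  positivity

theorem sliceLip_nonneg (h : IsDatum K A B ω₀ ρ₀) (hK : 0 ≤ K) {R : ℝ} (hR : 0 ≤ R) :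
    0 ≤ sliceLip K A B R := by
  have := h.nonneg_left
  have := h.nonneg_right
  unfold sliceLip
  positivity

theorem integrable_slice (h : IsDatum K A B ω₀ ρ₀) (hK : 0 ≤ K) (u : State) :
    Integrable fun w => slice K ω₀ ρ₀ w (u.1 w) (u.2 w) :=
  (integrable_exp_neg_abs.const_mul (sliceBound K A B ‖u‖)).mono'
    (h.continuous_slice.comp (f := fun w => (w, u.1 w, u.2 w))
      (by fun_prop)).aestronglyMeasurable
    (Filter.Eventually.of_forall fun w =>
      h.abs_slice_le hK (u.abs_fst_le w) (u.abs_snd_le w))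

theorem abs_velocity_le (h : IsDatum K A B ω₀ ρ₀) (hK : 0 ≤ K) {R : ℝ} {u : State} (hu : ‖u‖ ≤ R)
    (z : ℝ) : |1 / 2 * ∫ w in Ioi z, slice K ω₀ ρ₀ w (u.1 w) (u.2 w)| ≤
      sliceBound K A B R * ∫ w, exp (-|w|) := by
  have hR := (norm_nonneg u).trans hu
  have h1 := abs_integral_Ioi_le (h.sliceBound_nonneg hK hR)
    (fun w => h.abs_slice_le hK ((u.abs_fst_le w).trans hu) ((u.abs_snd_le w).trans hu)) z
  rw [abs_mul, abs_of_pos one_half_pos]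
  linarith [abs_nonneg (∫ w in Ioi z, slice K ω₀ ρ₀ w (u.1 w) (u.2 w))]

/-- The vector field on `State` whose integral curves from `0` are the solutions of the system. -/
noncomputable def field (h : IsDatum K A B ω₀ ρ₀) (hK : 0 ≤ K) (u : State) : State :=
  (.ofNormedAddCommGroup (fun z => 1 / 2 * ∫ w in Ioi z, slice K ω₀ ρ₀ w (u.1 w) (u.2 w))
    (continuous_const.mul (continuous_integral_Ioi (h.integrable_slice hK u)))
    (sliceBound K A B ‖u‖ * ∫ w, exp (-|w|)) (h.abs_velocity_le hK le_rfl),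
  .ofNormedAddCommGroup (fun z => exp (u.1 z / 2)) (by fun_prop) (exp (‖u‖ / 2)) fun z => by
    rw [Real.norm_eq_abs, abs_of_pos (exp_pos _), exp_le_exp]
    linarith [(abs_le.1 (u.abs_fst_le z)).2])

theorem field_fst_apply (h : IsDatum K A B ω₀ ρ₀) (hK : 0 ≤ K) (u : State) (z : ℝ) :
    (h.field hK u).1 z = 1 / 2 * ∫ w in Ioi z, slice K ω₀ ρ₀ w (u.1 w) (u.2 w) := rfl

theorem field_snd_apply (h : IsDatum K A B ω₀ ρ₀) (hK : 0 ≤ K) (u : State) (z : ℝ) :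
    (h.field hK u).2 z = exp (u.1 z / 2) := rfl

theorem norm_field_le (h : IsDatum K A B ω₀ ρ₀) (hK : 0 ≤ K) {R : ℝ} {u : State} (hu : ‖u‖ ≤ R) :
    ‖h.field hK u‖ ≤ sliceBound K A B R * (∫ w, exp (-|w|)) + exp (R / 2) := by
  have hR := (norm_nonneg u).trans hu
  have h0 := mul_nonneg (h.sliceBound_nonneg hK hR) integral_exp_neg_abs_nonneg
  have h1 := exp_pos (R / 2)
  rw [norm_prod_le_iff]
  constructor <;> refine (BoundedContinuousFunction.norm_le (by positivity)).2 fun z => ?_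
  · rw [field_fst_apply]
    exact (h.abs_velocity_le hK hu z).trans (by linarith)
  · rw [field_snd_apply, Real.norm_eq_abs, abs_of_pos (exp_pos _)]
    have : exp (u.1 z / 2) ≤ exp (R / 2) :=
      exp_le_exp.2 (by linarith [(abs_le.1 (u.abs_fst_le z)).2])
    linarith

theorem norm_field_sub_le (h : IsDatum K A B ω₀ ρ₀) (hK : 0 ≤ K) {R : ℝ} {u u' : State}
    (hu : ‖u‖ ≤ R) (hu' : ‖u'‖ ≤ R) :
    ‖h.field hK u - h.field hK u'‖ ≤
      (sliceLip K A B R * (∫ w, exp (-|w|)) + exp (R / 2)) * ‖u - u'‖ := by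
  have hR := (norm_nonneg u).trans hu
  have h0 := mul_nonneg (h.sliceLip_nonneg hK hR) integral_exp_neg_abs_nonneg
  have h1 := exp_pos (R / 2)
  have hd := norm_nonneg (u - u')
  rw [norm_prod_le_iff]
  constructor <;> refine (BoundedContinuousFunction.norm_le (by positivity)).2 fun z => ?_
  · rw [Prod.fst_sub, BoundedContinuousFunction.sub_apply, field_fst_apply, field_fst_apply,
      ← mul_sub, ← integral_sub (h.integrable_slice hK u).integrableOn
        (h.integrable_slice hK u').integrableOn, norm_mul, Real.norm_of_nonneg one_half_pos.le]
    have h2 := abs_integral_Ioi_le (mul_nonneg (h.sliceLip_nonneg hK hR) hd)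
      (fun w => (h.abs_slice_sub_le hK ((u.abs_fst_le w).trans hu) ((u.abs_snd_le w).trans hu)
        ((u'.abs_fst_le w).trans hu') ((u - u').abs_fst_le w)
        ((u - u').abs_snd_le w)).trans_eq (mul_right_comm _ _ _)) z
    rw [Real.norm_eq_abs]
    nlinarith [abs_nonneg (∫ w in Ioi z,
      (slice K ω₀ ρ₀ w (u.1 w) (u.2 w) - slice K ω₀ ρ₀ w (u'.1 w) (u'.2 w)))]
  · rw [Prod.snd_sub, BoundedContinuousFunction.sub_apply, field_snd_apply, field_snd_apply]
    refine (abs_exp_half_sub_le ((u.abs_fst_le z).trans hu) ((u'.abs_fst_le z).trans hu')).trans ?_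
    have h3 : |u.1 z - u'.1 z| ≤ ‖u - u'‖ := (u - u').abs_fst_le z
    nlinarith

theorem lipschitzOnWith_field (h : IsDatum K A B ω₀ ρ₀) (hK : 0 ≤ K) (R : ℝ) :
    LipschitzOnWith (sliceLip K A B R * (∫ w, exp (-|w|)) + exp (R / 2)).toNNReal (h.field hK)
      (Metric.closedBall 0 R) := by
  refine LipschitzOnWith.of_dist_le_mul fun u hu u' hu' => ?_
  rw [dist_eq_norm, dist_eq_norm]
  refine (h.norm_field_sub_le hK (mem_closedBall_zero_iff.1 hu)
    (mem_closedBall_zero_iff.1 hu')).trans ?_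
  gcongr
  exact Real.le_coe_toNNReal _

theorem continuous_field (h : IsDatum K A B ω₀ ρ₀) (hK : 0 ≤ K) : Continuous (h.field hK) := by
  refine continuous_iff_continuousAt.2 fun u => ?_
  refine (h.lipschitzOnWith_field hK (‖u‖ + 1)).continuousOn.continuousAt ?_
  refine Filter.mem_of_superset (Metric.ball_mem_nhds u one_pos) fun v hv => ?_
  rw [mem_closedBall_zero_iff]
  have := norm_le_norm_add_norm_sub u v
  have := mem_ball_iff_norm'.1 hv
  linarith

theorem exists_integral_curve (h : IsDatum K A B ω₀ ρ₀) (hK : 0 ≤ K) {T : ℝ} (hT : 0 ≤ T)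
    (hsmall : (sliceBound K A B 1 * (∫ w, exp (-|w|)) + exp (1 / 2)) * T ≤ 1) :
    ∃ u : ℝ → State, u 0 = 0 ∧
      ∀ t ∈ Icc 0 T, HasDerivWithinAt u (h.field hK (u t)) (Icc 0 T) t := by
  have hL : 0 ≤ sliceBound K A B 1 * (∫ w, exp (-|w|)) + exp (1 / 2) :=
    (norm_nonneg _).trans (h.norm_field_le hK (u := 0) (by simp))
  refine (IsPicardLindelof.of_time_independent (f := h.field hK) (tmin := 0) (tmax := T)
    (t₀ := ⟨0, le_rfl, hT⟩) (x₀ := 0) (a := 1) (r := 0)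
    (L := (sliceBound K A B 1 * (∫ w, exp (-|w|)) + exp (1 / 2)).toNNReal)
    (fun u hu => ?_) (h.lipschitzOnWith_field hK 1) ?_).exists_eq_forall_mem_Icc_hasDerivWithinAt₀
  · rw [Real.coe_toNNReal _ hL]
    exact h.norm_field_le hK (mem_closedBall_zero_iff.1 hu)
  · rw [Real.coe_toNNReal _ hL]
    simpa [hT] using hsmall

end IsDatum

/-- Evaluation of the displacement at `z`. -/
noncomputable def State.evalFst (z : ℝ) : State →L[ℝ] ℝ :=
  (BoundedContinuousFunction.evalCLM ℝ z).comp (ContinuousLinearMap.fst ℝ _ _)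

/-- Evaluation of the stretching factor at `z`. -/
noncomputable def State.evalSnd (z : ℝ) : State →L[ℝ] ℝ :=
  (BoundedContinuousFunction.evalCLM ℝ z).comp (ContinuousLinearMap.snd ℝ _ _)

namespace IsDatum

theorem integral_field_comp (h : IsDatum K A B ω₀ ρ₀) (hK : 0 ≤ K) {T : ℝ} {u : ℝ → State}
    (h0 : u 0 = 0) (hu : ∀ t ∈ Icc 0 T, HasDerivWithinAt u (h.field hK (u t)) (Icc 0 T) t)
    (l : State →L[ℝ] ℝ) {t : ℝ} (ht : t ∈ Icc 0 T) :
    ∫ s in (0 : ℝ)..t, l (h.field hK (u s)) = l (u t) := by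
  have hsub : Icc 0 t ⊆ Icc 0 T := Icc_subset_Icc_right ht.2
  have hcont : ContinuousOn u (Icc 0 T) := fun s hs => (hu s hs).continuousWithinAt
  have hint : IntervalIntegrable (fun s => l (h.field hK (u s))) volume 0 t := by
    refine ContinuousOn.intervalIntegrable ?_
    rw [uIcc_of_le ht.1]
    exact (l.continuous.comp (h.continuous_field hK)).comp_continuousOn (hcont.mono hsub)
  rw [intervalIntegral.integral_eq_sub_of_hasDerivAt_of_le (f := fun s => l (u s)) ht.1
    (l.continuous.comp_continuousOn (hcont.mono hsub)) (fun s hs => ?_) hint, h0, map_zero,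
    sub_zero]
  have hs' : s ∈ Ioo 0 T := ⟨hs.1, hs.2.trans_le ht.2⟩
  exact l.hasFDerivAt.comp_hasDerivAt s
    ((hu s (Ioo_subset_Icc_self hs')).hasDerivAt (Icc_mem_nhds hs'.1 hs'.2))

theorem isSolution_of_integral_curve (h : IsDatum K A B ω₀ ρ₀) (hK : 0 ≤ K) {T : ℝ}
    {u : ℝ → State} (h0 : u 0 = 0)
    (hu : ∀ t ∈ Icc 0 T, HasDerivWithinAt u (h.field hK (u t)) (Icc 0 T) t) :
    IsSolution T ω₀ ρ₀
      (fun z t => ω₀ (z.1, z.2 - (u t).1 z.1) +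
        exp ((z.2 - (u t).1 z.1 - z.1) / 2) * ρ₀ (z.1, z.2 - (u t).1 z.1) * (u t).2 z.1)
      (fun z t => (u t).1 z) := by
  have hcont : ContinuousOn u (Icc 0 T) := fun s hs => (hu s hs).continuousWithinAt
  obtain ⟨R, hR⟩ := isCompact_Icc.exists_bound_of_continuousOn hcont
  have hfst : ContinuousOn (fun p : ℝ × ℝ => (u p.2).1 p.1) (univ ×ˢ Icc 0 T) :=
    (continuous_fst.comp_continuousOn (hcont.comp continuousOn_snd fun p hp => hp.2)).eval
      continuousOn_fst
  have hsnd : ContinuousOn (fun p : ℝ × ℝ => (u p.2).2 p.1) (univ ×ˢ Icc 0 T) :=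
    (continuous_snd.comp_continuousOn (hcont.comp continuousOn_snd fun p hp => hp.2)).eval
      continuousOn_fst
  refine ⟨⟨A + exp (K / 2) * B * R, fun z t ht => ?_⟩,
    ⟨R, fun z t ht => ((u t).abs_fst_le z).trans (hR t ht)⟩, ?_, hfst,
    fun z t ht => ?_, fun z t ht => ?_⟩
  · have := h.abs_profile_le (w := z.1) (((u t).abs_snd_le z.1).trans (hR t ht))
      (z.2 - (u t).1 z.1 - z.1)
    rwa [profile, add_sub_cancel] at this
  · have hmap : MapsTo (fun p : (ℝ × ℝ) × ℝ => (p.1.1, p.2)) (univ ×ˢ Icc 0 T)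
        (univ ×ˢ Icc 0 T) := fun p hp => ⟨mem_univ _, hp.2⟩
    have h1 : ContinuousOn (fun p : (ℝ × ℝ) × ℝ => (u p.2).1 p.1.1) (univ ×ˢ Icc 0 T) :=
      hfst.comp (f := fun p : (ℝ × ℝ) × ℝ => (p.1.1, p.2)) (by fun_prop) hmap
    have h2 : ContinuousOn (fun p : (ℝ × ℝ) × ℝ => (u p.2).2 p.1.1) (univ ×ˢ Icc 0 T) :=
      hsnd.comp (f := fun p : (ℝ × ℝ) × ℝ => (p.1.1, p.2)) (by fun_prop) hmap
    have h3 : ContinuousOn (fun p : (ℝ × ℝ) × ℝ => (p.1.1, p.1.2 - (u p.2).1 p.1.1))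
        (univ ×ˢ Icc 0 T) := by fun_prop
    have h4 := h.continuous_vorticity.comp_continuousOn h3
    have h5 := h.continuous_density.comp_continuousOn h3
    exact h4.add ((ContinuousOn.mul (by fun_prop) h5).mul h2)
  · exact congrArg (fun e => ω₀ (z.1, z.2 - (u t).1 z.1) +
      exp ((z.2 - (u t).1 z.1 - z.1) / 2) * ρ₀ (z.1, z.2 - (u t).1 z.1) * e)
      (h.integral_field_comp hK h0 hu (State.evalSnd z.1) ht).symm
  · refine (h.integral_field_comp hK h0 hu (State.evalFst z) ht).symm.trans ?_
    rw [← intervalIntegral.integral_const_mul]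
    refine intervalIntegral.integral_congr fun s _ => ?_
    simp only [h.integral_transported hK]
    rfl

theorem exists_integral_curve_of_isSolution (h : IsDatum K A B ω₀ ρ₀) (hK : 0 ≤ K) {T : ℝ}
    (hT : 0 ≤ T) {ω : ℝ × ℝ → ℝ → ℝ} {Φ : ℝ → ℝ → ℝ} (hs : IsSolution T ω₀ ρ₀ ω Φ) :
    ∃ u : ℝ → State, u 0 = 0 ∧
      (∀ t ∈ Icc 0 T, HasDerivWithinAt u (h.field hK (u t)) (Icc 0 T) t) ∧
      ∀ z, ∀ t ∈ Icc 0 T, (u t).1 z = Φ z t := by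
  obtain ⟨-, ⟨M, hM⟩, -, hΦcont, hω, hΦ⟩ := hs
  let τ : ℝ → ℝ := fun t => projIcc 0 T hT t
  have hτ : ∀ t, τ t ∈ Icc 0 T := fun t => (projIcc 0 T hT t).2
  have hτ_eq : ∀ t ∈ Icc 0 T, τ t = t := fun t ht => by simp [τ, projIcc_of_mem hT ht]
  have hτ_cont : Continuous τ := continuous_subtype_val.comp continuous_projIcc
  have hM0 : 0 ≤ M := (abs_nonneg _).trans (hM 0 0 ⟨le_rfl, hT⟩)
  have hφ_cont : Continuous fun p : ℝ × ℝ => Φ p.1 (τ p.2) :=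
    hΦcont.comp_continuous (f := fun p : ℝ × ℝ => (p.1, τ p.2)) (by fun_prop)
      fun p => ⟨mem_univ _, hτ _⟩
  have hexp_le : ∀ z t, ‖exp (Φ z (τ t) / 2)‖ ≤ exp (M / 2) := fun z t => by
    rw [Real.norm_eq_abs, abs_of_pos (exp_pos _), exp_le_exp]
    linarith [(abs_le.1 (hM z _ (hτ t))).2]
  have hE_cont : Continuous fun p : ℝ × ℝ => ∫ s in (0 : ℝ)..τ p.2, exp (Φ p.1 (τ s) / 2) :=
    intervalIntegral.continuous_parametric_intervalIntegral_of_continuous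
      (f := fun (p : ℝ × ℝ) s => exp (Φ p.1 (τ s) / 2))
      (Real.continuous_exp.comp ((hφ_cont.comp
        (f := fun q : (ℝ × ℝ) × ℝ => (q.1.1, q.2)) (by fun_prop)).div_const 2)) (by fun_prop)
  have hE_le : ∀ z t, ‖∫ s in (0 : ℝ)..τ t, exp (Φ z (τ s) / 2)‖ ≤ exp (M / 2) * T := by
    intro z t
    refine (intervalIntegral.norm_integral_le_of_norm_le_const
      fun s _ => hexp_le z s).trans ?_
    rw [sub_zero, abs_of_nonneg (hτ t).1]
    exact mul_le_mul_of_nonneg_left (hτ t).2 (exp_pos _).le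
  let u : ℝ → State := fun t =>
    (.ofNormedAddCommGroup (fun z => Φ z (τ t))
        (hφ_cont.comp (continuous_id.prodMk continuous_const)) M fun z => hM z _ (hτ t),
      .ofNormedAddCommGroup (fun z => ∫ s in (0 : ℝ)..τ t, exp (Φ z (τ s) / 2))
        (hE_cont.comp (continuous_id.prodMk continuous_const)) _ fun z => hE_le z t)
  have hu1 : ∀ t z, (u t).1 z = Φ z (τ t) := fun t z => rfl
  have hu2 : ∀ t z, (u t).2 z = ∫ s in (0 : ℝ)..τ t, exp (Φ z (τ s) / 2) := fun t z => rfl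
  have hu_le : ∀ t, ‖u t‖ ≤ M + exp (M / 2) * T := fun t => by
    have := exp_pos (M / 2)
    refine (norm_prod_le_iff).2 ⟨?_, ?_⟩ <;>
      refine (BoundedContinuousFunction.norm_le (by positivity)).2 fun z => ?_
    · exact (hM z _ (hτ t)).trans (le_add_of_nonneg_right (by positivity))
    · exact (hE_le z t).trans (le_add_of_nonneg_left hM0)
  have hfst_eq : ∀ z t, (u t).1 z = ∫ s in (0 : ℝ)..τ t, (h.field hK (u s)).1 z := by
    intro z t
    rw [hu1, hΦ z _ (hτ t), ← intervalIntegral.integral_const_mul]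
    refine intervalIntegral.integral_congr fun s hs => ?_
    rw [uIcc_of_le (hτ t).1] at hs
    have hs' : s ∈ Icc 0 T := ⟨hs.1, hs.2.trans (hτ t).2⟩
    have hslice : ∀ w, ∫ z₂, ω (w, z₂) s / cosh z₂ = slice K ω₀ ρ₀ w ((u s).1 w) ((u s).2 w) := by
      intro w
      rw [← h.integral_transported hK]
      refine integral_congr_ae (Filter.Eventually.of_forall fun z₂ => ?_)
      have hE : (u s).2 w = ∫ r in (0 : ℝ)..s, exp (Φ w r / 2) := by
        rw [hu2, hτ_eq s hs']
        refine intervalIntegral.integral_congr fun r hr => ?_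
        rw [uIcc_of_le hs'.1] at hr
        simp only [hτ_eq r ⟨hr.1, hr.2.trans hs'.2⟩]
      simp only [hω (w, z₂) s hs', hE, hu1, hτ_eq s hs']
    simp only [hslice, field_fst_apply]
  have hsnd_eq : ∀ z t, (u t).2 z = ∫ s in (0 : ℝ)..τ t, (h.field hK (u s)).2 z := fun z t => rfl
  have hslice_cont : ∀ z, Continuous fun s => (h.field hK (u s)).1 z := by
    intro z
    simp only [field_fst_apply]
    refine continuous_const.mul (continuous_of_dominated
      (bound := fun w => sliceBound K A B (M + exp (M / 2) * T) * exp (-|w|))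
      (fun s => (h.integrable_slice hK (u s)).integrableOn.aestronglyMeasurable)
      (fun s => Filter.Eventually.of_forall fun w => h.abs_slice_le hK
        (((u s).abs_fst_le w).trans (hu_le s)) (((u s).abs_snd_le w).trans (hu_le s)))
      (integrable_exp_neg_abs.const_mul _).integrableOn
      (Filter.Eventually.of_forall fun w => ?_))
    refine h.continuous_slice.comp (f := fun s => (w, (u s).1 w, (u s).2 w)) ?_
    exact continuous_const.prodMk ((hφ_cont.comp (continuous_const.prodMk continuous_id)).prodMk
      (hE_cont.comp (continuous_const.prodMk continuous_id)))
  have hexp_cont : ∀ z, Continuous fun s => (h.field hK (u s)).2 z := fun z => by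
    simp only [field_snd_apply, hu1]
    exact Real.continuous_exp.comp
      ((hφ_cont.comp (continuous_const.prodMk continuous_id)).div_const 2)
  obtain ⟨L, hL⟩ : ∃ L, ∀ s, ‖h.field hK (u s)‖ ≤ L := ⟨_, fun s => h.norm_field_le hK (hu_le s)⟩
  have hL0 : 0 ≤ L := (norm_nonneg _).trans (hL 0)
  have hprimitive : ∀ g : ℝ → ℝ, Continuous g → (∀ s, |g s| ≤ L) → ∀ t t',
      ‖(∫ s in (0 : ℝ)..τ t, g s) - ∫ s in (0 : ℝ)..τ t', g s‖ ≤ L * |τ t - τ t'| := by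
    intro g hg hgL t t'
    rw [intervalIntegral.integral_interval_sub_left (hg.intervalIntegrable _ _)
      (hg.intervalIntegrable _ _)]
    exact intervalIntegral.norm_integral_le_of_norm_le_const fun s _ => hgL s
  have hu_lip : ∀ t t', ‖u t - u t'‖ ≤ L * |τ t - τ t'| := by
    intro t t'
    refine (norm_prod_le_iff).2 ⟨?_, ?_⟩ <;>
      refine (BoundedContinuousFunction.norm_le (by positivity)).2 fun z => ?_
    · rw [Prod.fst_sub, BoundedContinuousFunction.sub_apply, hfst_eq, hfst_eq]
      exact hprimitive _ (hslice_cont z) (fun s => (State.abs_fst_le _ z).trans (hL s)) t t'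
    · rw [Prod.snd_sub, BoundedContinuousFunction.sub_apply, hsnd_eq, hsnd_eq]
      exact hprimitive _ (hexp_cont z) (fun s => (State.abs_snd_le _ z).trans (hL s)) t t'
  have hu_cont : Continuous u := by
    refine continuous_iff_continuousAt.2 fun t => tendsto_iff_norm_sub_tendsto_zero.2 ?_
    refine squeeze_zero (fun _ => norm_nonneg _) (fun s => hu_lip s t) ?_
    have : Continuous fun s => L * |τ s - τ t| := by fun_prop
    simpa using this.tendsto t
  have hF_cont : Continuous fun s => h.field hK (u s) := (h.continuous_field hK).comp hu_cont
  have hu_eq : ∀ t ∈ Icc 0 T, u t = ∫ s in (0 : ℝ)..t, h.field hK (u s) := by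
    intro t ht
    have hcomm := fun l : State →L[ℝ] ℝ =>
      l.intervalIntegral_comp_comm (μ := volume) (hF_cont.intervalIntegrable 0 t)
    refine Prod.ext (BoundedContinuousFunction.ext fun z => ?_)
      (BoundedContinuousFunction.ext fun z => ?_)
    · rw [hfst_eq, hτ_eq t ht]
      exact hcomm (State.evalFst z)
    · rw [hsnd_eq, hτ_eq t ht]
      exact hcomm (State.evalSnd z)
  refine ⟨u, ?_, fun t ht => ?_, fun z t ht => by rw [hu1, hτ_eq t ht]⟩
  · rw [hu_eq 0 ⟨le_rfl, hT⟩, intervalIntegral.integral_same]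
  · exact (intervalIntegral.integral_hasDerivAt_right (hF_cont.intervalIntegrable 0 t)
      (hF_cont.stronglyMeasurableAtFilter _ _) hF_cont.continuousAt).hasDerivWithinAt.congr hu_eq
        (hu_eq t ht)

theorem integral_curve_unique (h : IsDatum K A B ω₀ ρ₀) (hK : 0 ≤ K) {T : ℝ}
    {u v : ℝ → State} (h0 : u 0 = v 0)
    (hu : ∀ t ∈ Icc 0 T, HasDerivWithinAt u (h.field hK (u t)) (Icc 0 T) t)
    (hv : ∀ t ∈ Icc 0 T, HasDerivWithinAt v (h.field hK (v t)) (Icc 0 T) t) :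
    EqOn u v (Icc 0 T) := by
  have hu_cont : ContinuousOn u (Icc 0 T) := fun s hs => (hu s hs).continuousWithinAt
  have hv_cont : ContinuousOn v (Icc 0 T) := fun s hs => (hv s hs).continuousWithinAt
  obtain ⟨R, hR⟩ := isCompact_Icc.exists_bound_of_continuousOn hu_cont
  obtain ⟨R', hR'⟩ := isCompact_Icc.exists_bound_of_continuousOn hv_cont
  have hright : ∀ {g : ℝ → State} {g' : State} {t : ℝ}, t ∈ Ico 0 T →
      HasDerivWithinAt g g' (Icc 0 T) t → HasDerivWithinAt g g' (Ici t) t := fun ht hg =>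
    hg.mono_of_mem_nhdsWithin (Filter.mem_of_superset (Icc_mem_nhdsGE ht.2)
      (Icc_subset_Icc_left ht.1))
  exact ODE_solution_unique_of_mem_Icc_right (v := fun _ => h.field hK)
    (s := fun _ => Metric.closedBall 0 (max R R'))
    (fun _ _ => h.lipschitzOnWith_field hK _)
    hu_cont (fun t ht => hright ht (hu t (Ico_subset_Icc_self ht)))
    (fun t ht => mem_closedBall_zero_iff.2
      ((hR t (Ico_subset_Icc_self ht)).trans (le_max_left _ _)))
    hv_cont (fun t ht => hright ht (hv t (Ico_subset_Icc_self ht)))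
    (fun t ht => mem_closedBall_zero_iff.2
      ((hR' t (Ico_subset_Icc_self ht)).trans (le_max_right _ _))) h0

theorem isSolution_unique (h : IsDatum K A B ω₀ ρ₀) (hK : 0 ≤ K) {T : ℝ} (hT : 0 ≤ T)
    {ω ω' : ℝ × ℝ → ℝ → ℝ} {Φ Φ' : ℝ → ℝ → ℝ} (hs : IsSolution T ω₀ ρ₀ ω Φ)
    (hs' : IsSolution T ω₀ ρ₀ ω' Φ') :
    (∀ z, ∀ t ∈ Icc 0 T, ω' z t = ω z t) ∧ ∀ z, ∀ t ∈ Icc 0 T, Φ' z t = Φ z t := by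
  obtain ⟨u, hu0, hu, huΦ⟩ := h.exists_integral_curve_of_isSolution hK hT hs
  obtain ⟨v, hv0, hv, hvΦ⟩ := h.exists_integral_curve_of_isSolution hK hT hs'
  have hΦ : ∀ z, ∀ t ∈ Icc 0 T, Φ' z t = Φ z t := fun z t ht => by
    rw [← huΦ z t ht, ← hvΦ z t ht, h.integral_curve_unique hK (hu0.trans hv0.symm) hu hv ht]
  refine ⟨fun z t ht => ?_, hΦ⟩
  obtain ⟨-, -, -, -, hω, -⟩ := hs
  obtain ⟨-, -, -, -, hω', -⟩ := hs'
  have hE : ∫ s in (0 : ℝ)..t, exp (Φ' z.1 s / 2) = ∫ s in (0 : ℝ)..t, exp (Φ z.1 s / 2) := by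
    refine intervalIntegral.integral_congr fun s hs => ?_
    rw [uIcc_of_le ht.1] at hs
    simp only [hΦ z.1 s ⟨hs.1, hs.2.trans ht.2⟩]
  rw [hω z t ht, hω' z t ht, hΦ z.1 t ht, hE]

end IsDatum

end Boussinesq

/-- Local well-posedness of the hyperbolic Boussinesq system (z-coordinates,
integral form): there is a time `T > 0`, depending only on `K` and on bounds for the
supremum norms of `ω₀`, `ρ₀` and their first derivatives, such that there is exactly
one bounded continuous pair `(ω, Φ)` on `ℝ² × [0,T]` solving the system. -/
theorem stmt_0 (K Mω Mω' Mρ Mρ' : ℝ) (hK : 0 < K) :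
    ∃ T : ℝ, 0 < T ∧
      ∀ ω₀ ρ₀ : ℝ × ℝ → ℝ,
        ContDiff ℝ 1 ω₀ → ContDiff ℝ 1 ρ₀ →
        (∀ z, |ω₀ z| ≤ Mω) → (∀ z, ‖fderiv ℝ ω₀ z‖ ≤ Mω') →
        (∀ z, |ρ₀ z| ≤ Mρ) → (∀ z, ‖fderiv ℝ ρ₀ z‖ ≤ Mρ') →
        (∀ z, 0 ≤ ω₀ z) → (∀ z, 0 ≤ ρ₀ z) →
        (∀ z : ℝ × ℝ, ω₀ z ≠ 0 → |z.1 - z.2| ≤ K ∧ z.1 + z.2 ≤ K) →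
        (∀ z : ℝ × ℝ, ρ₀ z ≠ 0 → |z.1 - z.2| ≤ K ∧ z.1 + z.2 ≤ K) →
        ∃ (ω : ℝ × ℝ → ℝ → ℝ) (Φ : ℝ → ℝ → ℝ),
          IsSolution T ω₀ ρ₀ ω Φ ∧
          ∀ (ω' : ℝ × ℝ → ℝ → ℝ) (Φ' : ℝ → ℝ → ℝ),
            IsSolution T ω₀ ρ₀ ω' Φ' →
            (∀ z : ℝ × ℝ, ∀ t ∈ Set.Icc (0:ℝ) T, ω' z t = ω z t) ∧
            (∀ z₁ : ℝ, ∀ t ∈ Set.Icc (0:ℝ) T, Φ' z₁ t = Φ z₁ t) := by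
  set L := Boussinesq.sliceBound K |Mω| |Mρ| 1 * (∫ w : ℝ, exp (-|w|)) + exp (1 / 2)
  have hLpos : 0 < L := by
    have := Boussinesq.integral_exp_neg_abs_nonneg
    have : 0 ≤ Boussinesq.sliceBound K |Mω| |Mρ| 1 := by
      unfold Boussinesq.sliceBound
      positivity
    positivity
  refine ⟨L⁻¹, inv_pos.2 hLpos, fun ω₀ ρ₀ hω₀ hρ₀ hω₀le _ hρ₀le _ _ _ hω₀supp hρ₀supp => ?_⟩
  have h : Boussinesq.IsDatum K |Mω| |Mρ| ω₀ ρ₀ :=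
    { continuous_vorticity := hω₀.continuous
      continuous_density := hρ₀.continuous
      vorticity_le := fun z => (hω₀le z).trans (le_abs_self _)
      density_le := fun z => (hρ₀le z).trans (le_abs_self _)
      vorticity_support := fun z hz => (hω₀supp z hz).1
      density_support := fun z hz => (hρ₀supp z hz).1 }
  obtain ⟨u, hu0, hu⟩ := h.exists_integral_curve hK.le (inv_pos.2 hLpos).le
    (mul_inv_cancel₀ hLpos.ne').le
  have hsol := h.isSolution_of_integral_curve hK.le hu0 hu
  exact ⟨_, _, hsol, fun ω' Φ' hs' =>
    h.isSolution_unique hK.le (inv_pos.2 hLpos).le hsol hs'⟩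
end

section
/- For every t ∈ [0,T]: (i) the supports of ω(·,t) and ρ(·,t) are contained in {x ∈ (0,∞)² : x₁ ≥ δ₀ e^{−B/2}}; and (ii) sup_x |ω(x,t)| ≤ ‖ω₀‖_∞ + δ₀^{−1} e^{3B} T ‖ρ₀‖_∞. -/
open MeasureTheory Real

/-- A priori control of the explicit solution formulas of the hyperbolic Boussinesq
system in the original coordinates: if `|Φ| ≤ B` then for `t ∈ [0,T]` the supports of
`ω(·,t)`, `ρ(·,t)` lie in `{x₁ ≥ δ₀ e^{-B/2}}` and
`|ω(x,t)| ≤ ‖ω₀‖_∞ + δ₀⁻¹ e^{3B} T ‖ρ₀‖_∞`. -/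
theorem stmt_1 (B T δ₀ Mω Mρ : ℝ) (hB : 0 < B) (hT : 0 < T) (hδ₀ : 0 < δ₀)
    (ω₀ ρ₀ : ℝ × ℝ → ℝ) (hω₀m : Measurable ω₀) (hρ₀m : Measurable ρ₀)
    (hω₀b : ∀ x, |ω₀ x| ≤ Mω) (hρ₀b : ∀ x, |ρ₀ x| ≤ Mρ)
    (hω₀s : ∀ x : ℝ × ℝ, ω₀ x ≠ 0 → δ₀ ≤ x.1)
    (hρ₀s : ∀ x : ℝ × ℝ, ρ₀ x ≠ 0 → δ₀ ≤ x.1)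
    (Φ : ℝ → ℝ → ℝ) (hΦm : Measurable (Function.uncurry Φ))
    (hΦb : ∀ z₁ t, |Φ z₁ t| ≤ B)
    (ρ ω : ℝ × ℝ → ℝ → ℝ)
    (hρ : ∀ (x : ℝ × ℝ) (t : ℝ), 0 < x.1 → 0 < x.2 → t ∈ Set.Icc (0:ℝ) T →
      ρ x t = ρ₀ (x.1 * Real.exp (Φ (Real.log (x.1 * x.2)) t / 2),
                  x.2 * Real.exp (-Φ (Real.log (x.1 * x.2)) t / 2)))
    (hω : ∀ (x : ℝ × ℝ) (t : ℝ), 0 < x.1 → 0 < x.2 → t ∈ Set.Icc (0:ℝ) T →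
      ω x t = ω₀ (x.1 * Real.exp (Φ (Real.log (x.1 * x.2)) t / 2),
                  x.2 * Real.exp (-Φ (Real.log (x.1 * x.2)) t / 2)) +
        x.1⁻¹ * ρ₀ (x.1 * Real.exp (Φ (Real.log (x.1 * x.2)) t / 2),
                    x.2 * Real.exp (-Φ (Real.log (x.1 * x.2)) t / 2)) *
          ∫ s in (0:ℝ)..t,
            Real.exp (-(Φ (Real.log (x.1 * x.2)) t - Φ (Real.log (x.1 * x.2)) s) / 2)) :
    ∀ (x : ℝ × ℝ) (t : ℝ), 0 < x.1 → 0 < x.2 → t ∈ Set.Icc (0:ℝ) T →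
      ((ω x t ≠ 0 ∨ ρ x t ≠ 0) → δ₀ * Real.exp (-B / 2) ≤ x.1) ∧
      |ω x t| ≤ Mω + δ₀⁻¹ * Real.exp (3 * B) * T * Mρ := by
  intro x t hx₁ hx₂ ht
  have hω' := hω x t hx₁ hx₂ ht
  have hρ' := hρ x t hx₁ hx₂ ht
  set z := Real.log (x.1 * x.2)
  set y : ℝ × ℝ := (x.1 * Real.exp (Φ z t / 2), x.2 * Real.exp (-Φ z t / 2))
  have hΦt := abs_le.1 (hΦb z t)
  have hsupp : δ₀ ≤ y.1 → δ₀ * Real.exp (-B / 2) ≤ x.1 := by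
    intro h
    calc δ₀ * Real.exp (-B / 2)
        ≤ (x.1 * Real.exp (Φ z t / 2)) * Real.exp (-B / 2) := by gcongr
      _ = x.1 * Real.exp (Φ z t / 2 + -B / 2) := by rw [Real.exp_add]; ring
      _ ≤ x.1 * 1 := by
          gcongr
          exact Real.exp_le_one_iff.2 (by linarith)
      _ = x.1 := mul_one _
  have hMρ : 0 ≤ Mρ := (abs_nonneg _).trans (hρ₀b y)
  refine ⟨fun h => hsupp ?_, ?_⟩
  · by_cases hρy : ρ₀ y = 0
    · refine hω₀s y fun hωy => ?_
      rcases h with h | h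
      · exact h (by simp [hω', hωy, hρy])
      · exact h (hρ'.trans hρy)
    · exact hρ₀s y hρy
  · rw [hω']
    refine (abs_add_le _ _).trans (add_le_add (hω₀b y) ?_)
    by_cases hρy : ρ₀ y = 0
    · rw [hρy, mul_zero, zero_mul, abs_zero]
      positivity
    have hx := hsupp (hρ₀s y hρy)
    have hinv : x.1⁻¹ ≤ δ₀⁻¹ * Real.exp (B / 2) := by
      calc x.1⁻¹ ≤ (δ₀ * Real.exp (-B / 2))⁻¹ := by gcongr
        _ = δ₀⁻¹ * Real.exp (B / 2) := by
          rw [mul_inv, ← Real.exp_neg]; congr 2; ring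
    have hint : |∫ s in (0:ℝ)..t, Real.exp (-(Φ z t - Φ z s) / 2)| ≤ Real.exp B * T := by
      have h := intervalIntegral.norm_integral_le_of_norm_le_const (a := 0) (b := t)
        (f := fun s => Real.exp (-(Φ z t - Φ z s) / 2)) (C := Real.exp B) (by
          intro s _
          have hΦs := abs_le.1 (hΦb z s)
          rw [Real.norm_eq_abs, Real.abs_exp]
          exact Real.exp_le_exp.2 (by linarith))
      rw [Real.norm_eq_abs, sub_zero, abs_of_nonneg ht.1] at h
      exact h.trans (by gcongr; exact ht.2)
    rw [abs_mul, abs_mul, abs_of_pos (inv_pos.2 hx₁)]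
    calc x.1⁻¹ * |ρ₀ y| * |∫ s in (0:ℝ)..t, Real.exp (-(Φ z t - Φ z s) / 2)|
        ≤ (δ₀⁻¹ * Real.exp (B / 2)) * Mρ * (Real.exp B * T) := by
          gcongr
          exact hρ₀b y
      _ = δ₀⁻¹ * Real.exp (B / 2 + B) * T * Mρ := by rw [Real.exp_add]; ring
      _ ≤ δ₀⁻¹ * Real.exp (3 * B) * T * Mρ := by
          gcongr
          linarith
end

section
/- The function Ω is differentiable on (0,∞), its derivative satisfies Ω'(η) = −∫_δ^R ω(y₁, η/y₁) / (y₁ · (y₁² + η²/y₁²)) dy₁ for every η > 0, and |Ω'(η)| ≤ ‖ω‖_∞ / (2δ²) for every η > 0. -/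
open MeasureTheory Real

theorem kernel_denominator_lower_bound {δ R a : ℝ} (hδ : 0 < δ) (ha : a ∈ Set.Icc δ R) (z : ℝ) :
    min (δ ^ 3) R⁻¹ * (1 + z ^ 2) ≤ a * (a ^ 2 + z ^ 2 / a ^ 2) := by
  obtain ⟨h1, h2⟩ := ha
  have ha0 : 0 < a := hδ.trans_le h1
  have h3 : a * (a ^ 2 + z ^ 2 / a ^ 2) = a ^ 3 + a⁻¹ * z ^ 2 := by field_simp
  have h4 : δ ^ 3 ≤ a ^ 3 := by gcongr
  have h5 : R⁻¹ ≤ a⁻¹ := by gcongr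
  have h6 : min (δ ^ 3) R⁻¹ * z ^ 2 ≤ a⁻¹ * z ^ 2 := by
    gcongr
    exact (min_le_right _ _).trans h5
  have h7 := (min_le_left (δ ^ 3) R⁻¹).trans h4
  linarith

theorem abs_kernel_le {δ R M a : ℝ} (hδ : 0 < δ) {ω : ℝ × ℝ → ℝ} (hM : ∀ y, |ω y| ≤ M)
    (ha : a ∈ Set.Icc δ R) (z : ℝ) :
    |ω (a, z / a) / (a * (a ^ 2 + z ^ 2 / a ^ 2))| ≤
      M / min (δ ^ 3) R⁻¹ * (1 + z ^ 2)⁻¹ := by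
  have ha0 : 0 < a := hδ.trans_le ha.1
  have hR : 0 < R := ha0.trans_le ha.2
  have hM0 : 0 ≤ M := (abs_nonneg _).trans (hM 0)
  have hc : 0 < min (δ ^ 3) R⁻¹ := by positivity
  have hden : 0 < a * (a ^ 2 + z ^ 2 / a ^ 2) := by positivity
  rw [abs_div, abs_of_pos hden, ← div_eq_mul_inv, div_div]
  exact div_le_div₀ hM0 (hM _) (by positivity) (kernel_denominator_lower_bound hδ ha z)

theorem integrable_kernel {δ R M : ℝ} (hδ : 0 < δ) {ω : ℝ × ℝ → ℝ}
    (hcont : Continuous ω) (hM : ∀ y, |ω y| ≤ M) :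
    Integrable (fun p : ℝ × ℝ => ω (p.1, p.2 / p.1) / (p.1 * (p.1 ^ 2 + p.2 ^ 2 / p.1 ^ 2)))
      ((volume.restrict (Set.Icc δ R)).prod volume) := by
  have hmeas := hcont.measurable
  have hdom : Integrable (fun p : ℝ × ℝ => (M / min (δ ^ 3) R⁻¹) * (1 + p.2 ^ 2)⁻¹)
      ((volume.restrict (Set.Icc δ R)).prod volume) :=
    (integrable_const (μ := volume.restrict (Set.Icc δ R)) (M / min (δ ^ 3) R⁻¹)).mul_prod
      integrable_inv_one_add_sq
  refine hdom.mono' (Measurable.aestronglyMeasurable (by fun_prop)) ?_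
  have hmem : ∀ᵐ p : ℝ × ℝ ∂((volume.restrict (Set.Icc δ R)).prod volume),
      p.1 ∈ Set.Icc δ R :=
    Measure.quasiMeasurePreserving_fst.ae (ae_restrict_mem measurableSet_Icc)
  filter_upwards [hmem] with p hp
  exact abs_kernel_le hδ hM hp p.2

theorem continuous_integral_kernel {δ R M : ℝ} (hδ : 0 < δ) {ω : ℝ × ℝ → ℝ}
    (hcont : Continuous ω) (hM : ∀ y, |ω y| ≤ M) :
    Continuous (fun z : ℝ => ∫ a in Set.Icc δ R,
      ω (a, z / a) / (a * (a ^ 2 + z ^ 2 / a ^ 2))) := by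
  have hmeas := hcont.measurable
  refine continuous_of_dominated (bound := fun _ => M / min (δ ^ 3) R⁻¹)
    (fun z => Measurable.aestronglyMeasurable (by fun_prop)) (fun z => ?_)
    (integrable_const _) ?_
  · filter_upwards [ae_restrict_mem measurableSet_Icc] with a ha
    refine (abs_kernel_le hδ hM ha z).trans (mul_le_of_le_one_right ?_ ?_)
    · have hM0 : 0 ≤ M := (abs_nonneg _).trans (hM 0)
      have hR : 0 < R := hδ.trans_le (ha.1.trans ha.2)
      positivity
    · exact inv_le_one_of_one_le₀ (by nlinarith [sq_nonneg z])
  · filter_upwards [ae_restrict_mem measurableSet_Icc] with a ha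
    have ha0 : 0 < a := hδ.trans_le ha.1
    have hden : ∀ z : ℝ, a * (a ^ 2 + z ^ 2 / a ^ 2) ≠ 0 := fun z => by positivity
    exact Continuous.div (by fun_prop) (by fun_prop) hden

theorem integrable_div_sq_add_sq {δ R M : ℝ} (hδ : 0 < δ) {ω : ℝ × ℝ → ℝ}
    (hcont : Continuous ω) (hM : ∀ y, |ω y| ≤ M)
    (hsupp : ∀ y : ℝ × ℝ, ω y ≠ 0 → δ ≤ y.1 ∧ y.1 ≤ R) :
    Integrable (fun y : ℝ × ℝ => ω y / (y.1 ^ 2 + y.2 ^ 2)) := by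
  have hmeas := hcont.measurable
  have hM0 : 0 ≤ M := (abs_nonneg _).trans (hM 0)
  have hc : 0 < min (δ ^ 2) 1 := by positivity
  have hdom : Integrable (fun p : ℝ × ℝ =>
      (Set.Icc δ R).indicator (fun _ => M / min (δ ^ 2) 1) p.1 * (1 + p.2 ^ 2)⁻¹) :=
    ((integrable_indicator_iff measurableSet_Icc).2
      (integrableOn_const (by simp))).mul_prod integrable_inv_one_add_sq
  refine hdom.mono' (Measurable.aestronglyMeasurable (by fun_prop)) (.of_forall fun p => ?_)
  by_cases hp : p.1 ∈ Set.Icc δ R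
  · rw [Set.indicator_of_mem hp, norm_eq_abs, abs_div, ← div_eq_mul_inv, div_div,
      abs_of_nonneg (by positivity : 0 ≤ p.1 ^ 2 + p.2 ^ 2)]
    refine div_le_div₀ hM0 (hM _) (by positivity) ?_
    have h1 : δ ^ 2 ≤ p.1 ^ 2 := by
      have := hp.1
      gcongr
    have h2 := min_le_left (δ ^ 2) 1
    have h3 := mul_le_mul_of_nonneg_right (min_le_right (δ ^ 2) 1) (sq_nonneg p.2)
    linarith
  · have h0 : ω p = 0 := by
      by_contra h
      exact hp (hsupp p h)
    simp [h0, Set.indicator_of_notMem hp]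

theorem setIntegral_hyperbola_eq {δ R M : ℝ} (hδ : 0 < δ) {ω : ℝ × ℝ → ℝ}
    (hcont : Continuous ω) (hM : ∀ y, |ω y| ≤ M)
    (hsupp : ∀ y : ℝ × ℝ, ω y ≠ 0 → δ ≤ y.1 ∧ y.1 ≤ R) {η : ℝ} (hη : 0 < η) :
    ∫ y in {y : ℝ × ℝ | 0 < y.1 ∧ 0 < y.2 ∧ η ≤ y.1 * y.2}, ω y / (y.1 ^ 2 + y.2 ^ 2) =
      ∫ z in Set.Ioi η, ∫ a in Set.Icc δ R,
        ω (a, z / a) / (a * (a ^ 2 + z ^ 2 / a ^ 2)) := by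
  have hS : MeasurableSet {y : ℝ × ℝ | 0 < y.1 ∧ 0 < y.2 ∧ η ≤ y.1 * y.2} :=
    (measurableSet_lt measurable_const measurable_fst).inter
      ((measurableSet_lt measurable_const measurable_snd).inter
        (measurableSet_le measurable_const (measurable_fst.mul measurable_snd)))
  have hint := (integrable_div_sq_add_sq hδ hcont hM hsupp).indicator hS
  have hker : Integrable
      (fun p : ℝ × ℝ => ω (p.1, p.2 / p.1) / (p.1 * (p.1 ^ 2 + p.2 ^ 2 / p.1 ^ 2)))
      ((volume.restrict (Set.Icc δ R)).prod (volume.restrict (Set.Ioi η))) :=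
    (integrable_kernel hδ hcont hM).mono_measure
      (Measure.prod_mono le_rfl Measure.restrict_le_self)
  have hswap := integral_integral_swap
    (f := fun a z => ω (a, z / a) / (a * (a ^ 2 + z ^ 2 / a ^ 2))) hker
  rw [← integral_indicator hS, Measure.volume_eq_prod, integral_prod _ hint,
    ← hswap, ← integral_indicator measurableSet_Icc]
  congr 1 with a
  by_cases ha : a ∈ Set.Icc δ R
  · have ha0 : 0 < a := hδ.trans_le ha.1
    have hslice : (fun b : ℝ => {y : ℝ × ℝ | 0 < y.1 ∧ 0 < y.2 ∧ η ≤ y.1 * y.2}.indicator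
        (fun y => ω y / (y.1 ^ 2 + y.2 ^ 2)) (a, b)) =
        (Set.Ici (η / a)).indicator (fun b => ω (a, b) / (a ^ 2 + b ^ 2)) := by
      ext b
      have hiff : (a, b) ∈ {y : ℝ × ℝ | 0 < y.1 ∧ 0 < y.2 ∧ η ≤ y.1 * y.2} ↔
          b ∈ Set.Ici (η / a) := by
        simp only [Set.mem_ofPred_eq, Set.mem_Ici, div_le_iff₀' ha0]
        exact ⟨fun h => h.2.2, fun h =>
          ⟨ha0, pos_of_mul_pos_right (hη.trans_le h) ha0.le, h⟩⟩
      by_cases hb : b ∈ Set.Ici (η / a)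
      · rw [Set.indicator_of_mem hb, Set.indicator_of_mem (hiff.2 hb)]
      · rw [Set.indicator_of_notMem hb, Set.indicator_of_notMem (mt hiff.1 hb)]
    have hsub := integral_comp_mul_left_Ioi (fun b => ω (a, b) / (a ^ 2 + b ^ 2)) η
      (inv_pos.2 ha0)
    rw [Set.indicator_of_mem ha, hslice, integral_indicator measurableSet_Ici,
      integral_Ici_eq_integral_Ioi, div_eq_inv_mul η a,
      ← inv_mul_cancel_left₀ ha0.ne'
        (∫ b in Set.Ioi (a⁻¹ * η), ω (a, b) / (a ^ 2 + b ^ 2))]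
    rw [inv_inv, smul_eq_mul] at hsub
    rw [← hsub, ← integral_const_mul]
    congr 1 with z
    rw [← div_eq_inv_mul z a, div_pow, ← div_eq_inv_mul, div_div, mul_comm a]
  · have h0 : ∀ b, ω (a, b) = 0 := fun b => by
      by_contra h
      exact ha (hsupp (a, b) h)
    rw [Set.indicator_of_notMem ha]
    simp [Set.indicator, h0]

theorem abs_integral_kernel_le {δ R M : ℝ} (hδ : 0 < δ) (hδR : δ ≤ R) {ω : ℝ × ℝ → ℝ}
    (hM : ∀ y, |ω y| ≤ M) (η : ℝ) :
    |∫ a in δ..R, ω (a, η / a) / (a * (a ^ 2 + η ^ 2 / a ^ 2))| ≤ M / (2 * δ ^ 2) := by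
  have hM0 : 0 ≤ M := (abs_nonneg _).trans (hM 0)
  have hR : 0 < R := hδ.trans_le hδR
  have h0 : (0 : ℝ) ∉ Set.uIcc δ R := by
    rw [Set.uIcc_of_le hδR]
    exact fun h => hδ.not_ge h.1
  have hpow : ∫ a in δ..R, M * a ^ (-3 : ℤ) = M * ((R ^ (-2 : ℤ) - δ ^ (-2 : ℤ)) / (-2)) := by
    rw [intervalIntegral.integral_const_mul, integral_zpow (Or.inr ⟨by norm_num, h0⟩)]
    norm_num
  have hle : |∫ a in δ..R, ω (a, η / a) / (a * (a ^ 2 + η ^ 2 / a ^ 2))| ≤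
      ∫ a in δ..R, M * a ^ (-3 : ℤ) := by
    rw [← norm_eq_abs]
    refine intervalIntegral.norm_integral_le_of_norm_le hδR (.of_forall fun a ha => ?_)
      ((intervalIntegral.intervalIntegrable_zpow (μ := volume) (Or.inr h0)).const_mul M)
    have ha0 : 0 < a := hδ.trans ha.1
    have hden : a ^ 3 ≤ a * (a ^ 2 + η ^ 2 / a ^ 2) := by
      have : 0 ≤ a * (η ^ 2 / a ^ 2) := by positivity
      nlinarith
    rw [norm_eq_abs, abs_div, abs_of_pos (by positivity : 0 < a * (a ^ 2 + η ^ 2 / a ^ 2)),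
      zpow_neg, ← div_eq_mul_inv]
    exact div_le_div₀ hM0 (hM _) (by positivity) (by exact_mod_cast hden)
  refine hle.trans (hpow.trans_le ?_)
  have hRpos : 0 ≤ M * R ^ (-2 : ℤ) := by positivity
  have hδeq : M / (2 * δ ^ 2) = M * δ ^ (-2 : ℤ) / 2 := by
    rw [zpow_neg]
    norm_cast
    field_simp
  rw [hδeq]
  linarith

/-- For bounded continuous `ω` supported in `{δ ≤ y₁ ≤ R}`, the function
`Ω(η) = ∫_{y₁y₂ ≥ η} ω(y)/|y|² dy` is differentiable on `(0,∞)` with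
`Ω'(η) = -∫_δ^R ω(y₁, η/y₁)/(y₁(y₁² + η²/y₁²)) dy₁`, and `|Ω'(η)| ≤ M/(2δ²)`
where `M` is a bound for `|ω|`. -/
theorem stmt_2 (δ R M : ℝ) (hδ : 0 < δ) (hδR : δ < R) (ω : ℝ × ℝ → ℝ)
    (hcont : Continuous ω) (hM : ∀ y, |ω y| ≤ M)
    (hsupp : ∀ y : ℝ × ℝ, ω y ≠ 0 → δ ≤ y.1 ∧ y.1 ≤ R) :
    ∀ η ∈ Set.Ioi (0:ℝ),
      HasDerivAt
        (fun η' : ℝ =>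
          ∫ y in {y : ℝ × ℝ | 0 < y.1 ∧ 0 < y.2 ∧ η' ≤ y.1 * y.2},
            ω y / (y.1 ^ 2 + y.2 ^ 2))
        (-(∫ y₁ in δ..R, ω (y₁, η / y₁) / (y₁ * (y₁ ^ 2 + η ^ 2 / y₁ ^ 2)))) η ∧
      |∫ y₁ in δ..R, ω (y₁, η / y₁) / (y₁ * (y₁ ^ 2 + η ^ 2 / y₁ ^ 2))| ≤
        M / (2 * δ ^ 2) := by
  intro η hη
  refine ⟨?_, abs_integral_kernel_le hδ hδR.le hM η⟩
  set g : ℝ → ℝ := fun z => ∫ a in Set.Icc δ R,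
    ω (a, z / a) / (a * (a ^ 2 + z ^ 2 / a ^ 2)) with hg
  have hgcont : Continuous g := continuous_integral_kernel hδ hcont hM
  have hgint : Integrable g := (integrable_kernel hδ hcont hM).integral_prod_right
  have hgη : ∫ y₁ in δ..R, ω (y₁, η / y₁) / (y₁ * (y₁ ^ 2 + η ^ 2 / y₁ ^ 2)) = g η := by
    rw [intervalIntegral.integral_of_le hδR.le, ← integral_Icc_eq_integral_Ioc]
  rw [hgη]
  have hderiv : HasDerivAt (fun η' => (∫ z in Set.Ioi 0, g z) - ∫ z in (0 : ℝ)..η', g z)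
      (-g η) η :=
    (hgcont.integral_hasStrictDerivAt 0 η).hasDerivAt.const_sub _
  refine hderiv.congr_of_eventuallyEq ?_
  filter_upwards [Ioi_mem_nhds hη] with η' hη'
  rw [setIntegral_hyperbola_eq hδ hcont hM hsupp hη',
    ← intervalIntegral.integral_Ioi_sub_Ioi hgint.integrableOn (Set.mem_Ioi.1 hη').le,
    sub_sub_cancel]
end

section
/- There exists a constant C > 0 depending only on K such that for all t ∈ [0,T] and all z₁ ∈ ℝ: |Φ(z₁,t)| ≤ exp(C ∫₀ᵗ (1 + sup_z |ω(z,s)|) ds) − 1. -/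
open MeasureTheory Real

/-- An integral form of Grönwall's inequality, with a lossy factor `2` in the exponent. -/
theorem le_mul_exp_of_sub_le_mul_sub {u k : ℝ → ℝ} {T L : ℝ}
    (hu : ∀ t ∈ Set.Icc 0 T, 0 ≤ u t)
    (huk : ∀ s t, 0 ≤ s → s ≤ t → t ≤ T → u t - u s ≤ u t * (k t - k s))
    (hk : ∀ s t, 0 ≤ s → s ≤ t → t ≤ T → k t - k s ≤ L * (t - s))
    (hmono : ∀ s t, 0 ≤ s → s ≤ t → t ≤ T → k s ≤ k t) {t : ℝ} (ht : t ∈ Set.Icc 0 T) :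
    u t ≤ u 0 * exp (2 * (k t - k 0)) := by
  have hexp : ∀ x : ℝ, 0 ≤ x → x ≤ 1 / 2 → 1 ≤ (1 - x) * exp (2 * x) := by
    intro x hx hx'
    have h := add_one_le_exp (2 * x)
    nlinarith
  have key : ∀ n : ℕ, ∀ t ∈ Set.Icc 0 T, L * t ≤ n / 2 →
      u t ≤ u 0 * exp (2 * (k t - k 0)) := by
    intro n
    induction n with
    | zero =>
      intro t ht hL
      have h1 := huk 0 t le_rfl ht.1 ht.2
      have h2 := hk 0 t le_rfl ht.1 ht.2
      have h3 := hmono 0 t le_rfl ht.1 ht.2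
      have h4 : k t - k 0 = 0 := by
        norm_num at hL
        linarith
      rw [h4] at h1 ⊢
      simp at h1 ⊢
      exact h1
    | succ n ih =>
      intro t ht hL
      have hn : (0 : ℝ) < n + 1 := by positivity
      push_cast at hL
      set s := t * (n / (n + 1)) with hs
      have hs0 : 0 ≤ s := mul_nonneg ht.1 (by positivity)
      have hts : t - s = t / (n + 1) := by rw [hs]; field_simp; ring
      have hst : s ≤ t := by
        have : 0 ≤ t / (n + 1) := div_nonneg ht.1 hn.le
        linarith
      have hLs : L * s ≤ n / 2 := by
        have h : L * s = (L * t) * (n / (n + 1)) := by rw [hs]; ring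
        rw [h]
        calc L * t * (n / (n + 1)) ≤ ((n + 1) / 2) * (n / (n + 1)) := by gcongr
          _ = n / 2 := by field_simp
      have hLts : L * (t - s) ≤ 1 / 2 := by
        rw [hts, ← mul_div_assoc, div_le_iff₀ hn]
        linarith
      have hinc := hk s t hs0 hst ht.2
      have hinc0 := hmono s t hs0 hst ht.2
      have hx := hexp (k t - k s) (by linarith) (by linarith)
      have hstep := huk s t hs0 hst ht.2
      have hut := hu t ht
      calc u t = u t * 1 := (mul_one _).symm
        _ ≤ u t * ((1 - (k t - k s)) * exp (2 * (k t - k s))) := by gcongr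
        _ = (u t * (1 - (k t - k s))) * exp (2 * (k t - k s)) := by ring
        _ ≤ u s * exp (2 * (k t - k s)) := by gcongr; linarith
        _ ≤ (u 0 * exp (2 * (k s - k 0))) * exp (2 * (k t - k s)) := by
          gcongr
          exact ih s ⟨hs0, hst.trans ht.2⟩ hLs
        _ = u 0 * exp (2 * (k t - k 0)) := by
          rw [mul_assoc, ← exp_add]
          ring_nf
  obtain ⟨n, hn⟩ := exists_nat_ge (2 * (L * t))
  exact key n t ht (by linarith)

theorem integral_le_of_support_subset_Icc {g : ℝ → ℝ} {a K c : ℝ} (hK : 0 ≤ K)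
    (hg : ∀ z, 0 ≤ g z) (hgc : ∀ z, |z - a| ≤ K → g z ≤ c) (hsupp : ∀ z, g z ≠ 0 → |z - a| ≤ K) :
    ∫ z, g z ≤ 2 * K * c := by
  have hmem : ∀ z, |z - a| ≤ K ↔ z ∈ Set.Icc (a - K) (a + K) := fun z ↦ by
    rw [abs_le, Set.mem_Icc]
    constructor <;> rintro ⟨h1, h2⟩ <;> constructor <;> linarith
  have hint : Integrable ((Set.Icc (a - K) (a + K)).indicator fun _ ↦ c) :=
    (integrable_indicator_iff measurableSet_Icc).2 (integrableOn_const (by simp))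
  calc ∫ z, g z ≤ ∫ z, (Set.Icc (a - K) (a + K)).indicator (fun _ ↦ c) z := by
        refine integral_mono_of_nonneg (.of_forall hg) hint (.of_forall fun z ↦ ?_)
        by_cases hz : |z - a| ≤ K
        · simpa [Set.indicator_of_mem ((hmem z).1 hz)] using hgc z hz
        · have h0 : g z = 0 := by_contra fun h ↦ hz (hsupp z h)
          simp only [h0]
          rw [Set.indicator_of_notMem (mt (hmem z).2 hz)]
    _ = 2 * K * c := by
        rw [integral_indicator measurableSet_Icc, setIntegral_const, measureReal_def,
          Real.volume_Icc, ENNReal.toReal_ofReal (by linarith), smul_eq_mul]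
        ring

theorem inv_cosh_le_two_mul_exp (z : ℝ) : 1 / cosh z ≤ 2 * exp z := by
  rw [div_le_iff₀ (cosh_pos z), cosh_eq]
  have h : exp z * exp (-z) = 1 := by rw [← exp_add]; simp
  nlinarith [mul_pos (exp_pos z) (exp_pos z)]

section Slice

/- A time slice `f` of the vorticity, supported in a strip of half-width `K` around the curve
`z = w + p w`, `w ≤ K`. -/
variable {f : ℝ × ℝ → ℝ} {p : ℝ → ℝ} {K W : ℝ}

theorem integral_div_cosh_nonneg (hf : ∀ z, 0 ≤ f z) (w : ℝ) : 0 ≤ ∫ z, f (w, z) / cosh z :=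
  integral_nonneg fun z ↦ div_nonneg (hf _) (cosh_pos z).le

theorem integral_div_cosh_eq_zero (hsupp : ∀ z : ℝ × ℝ, f z ≠ 0 → z.1 ≤ K) {w : ℝ} (hw : K < w) :
    ∫ z, f (w, z) / cosh z = 0 := by
  have h : ∀ z, f (w, z) = 0 := fun z ↦ by_contra fun h ↦ hw.not_ge (hsupp _ h)
  simp [h]

theorem integral_div_cosh_le (hK : 0 ≤ K) (hf : ∀ z, 0 ≤ f z) (hfW : ∀ z, f z ≤ W)
    (hsupp : ∀ z : ℝ × ℝ, f z ≠ 0 → |z.2 - (z.1 + p z.1)| ≤ K) (w : ℝ) :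
    ∫ z, f (w, z) / cosh z ≤ 2 * K * W := by
  refine integral_le_of_support_subset_Icc (a := w + p w) hK
    (fun z ↦ div_nonneg (hf _) (cosh_pos z).le) (fun z _ ↦ ?_)
    fun z hz ↦ hsupp (w, z) fun h ↦ hz (by simp [h])
  exact (div_le_self (hf _) (one_le_cosh z)).trans (hfW _)

theorem integral_div_cosh_le_exp (hK : 0 ≤ K) (hf : ∀ z, 0 ≤ f z) (hfW : ∀ z, f z ≤ W)
    (hsupp : ∀ z : ℝ × ℝ, f z ≠ 0 → |z.2 - (z.1 + p z.1)| ≤ K) (w : ℝ) :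
    ∫ z, f (w, z) / cosh z ≤ 4 * K * exp K * W * exp (w + p w) := by
  have hW : 0 ≤ W := (hf (0, 0)).trans (hfW _)
  have h : ∫ z, f (w, z) / cosh z ≤ 2 * K * (W * (2 * exp (w + p w + K))) := by
    refine integral_le_of_support_subset_Icc (a := w + p w) hK
      (fun z ↦ div_nonneg (hf _) (cosh_pos z).le) (fun z hz ↦ ?_)
      fun z hz ↦ hsupp (w, z) fun h ↦ hz (by simp [h])
    rw [div_eq_mul_one_div]
    have hz' : z ≤ w + p w + K := by linarith [(abs_le.1 hz).2]
    have hpos : 0 ≤ 1 / cosh z := (one_div_pos.2 (cosh_pos z)).le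
    have h1 : 1 / cosh z ≤ 2 * exp (w + p w + K) :=
      (inv_cosh_le_two_mul_exp z).trans (by gcongr)
    exact mul_le_mul (hfW _) h1 hpos hW
  calc _ ≤ _ := h
    _ = _ := by rw [exp_add _ K]; ring

theorem integrableOn_integral_div_cosh (hK : 0 ≤ K) (hcont : Continuous f) (hf : ∀ z, 0 ≤ f z)
    (hfW : ∀ z, f z ≤ W)
    (hsupp : ∀ z : ℝ × ℝ, f z ≠ 0 → z.1 ≤ K ∧ |z.2 - (z.1 + p z.1)| ≤ K) (x : ℝ) :
    IntegrableOn (fun w ↦ ∫ z, f (w, z) / cosh z) (Set.Ioi x) := by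
  have hmeas : StronglyMeasurable fun w ↦ ∫ z, f (w, z) / cosh z := by
    refine StronglyMeasurable.integral_prod_right
      (f := fun w z ↦ f (w, z) / cosh z) (Continuous.stronglyMeasurable ?_)
    exact Continuous.div (by fun_prop) (by fun_prop) fun q ↦ (cosh_pos _).ne'
  have hdom : Integrable ((Set.Ioc x K).indicator fun _ ↦ 2 * K * W)
      (volume.restrict (Set.Ioi x)) :=
    ((integrable_indicator_iff measurableSet_Ioc).2 (integrableOn_const (by simp))).integrableOn
  refine hdom.mono' hmeas.aestronglyMeasurable ?_
  refine (ae_restrict_mem measurableSet_Ioi).mono fun w hw ↦ ?_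
  rw [norm_of_nonneg (integral_div_cosh_nonneg hf w)]
  by_cases hwK : w ≤ K
  · rw [Set.indicator_of_mem (s := Set.Ioc x K) ⟨hw, hwK⟩]
    exact integral_div_cosh_le hK hf hfW (fun z hz ↦ (hsupp z hz).2) w
  · rw [integral_div_cosh_eq_zero (fun z hz ↦ (hsupp z hz).1) (not_le.1 hwK)]
    rw [Set.indicator_of_notMem fun h ↦ hwK h.2]

theorem setIntegral_Ioi_integral_div_cosh_le_const (hK : 0 ≤ K) (hf : ∀ z, 0 ≤ f z)
    (hfW : ∀ z, f z ≤ W)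
    (hsupp : ∀ z : ℝ × ℝ, f z ≠ 0 → z.1 ≤ K ∧ |z.2 - (z.1 + p z.1)| ≤ K) (x : ℝ) :
    ∫ w in Set.Ioi x, ∫ z, f (w, z) / cosh z ≤ 2 * K * W * max (K - x) 0 := by
  have hdom : Integrable ((Set.Ioc x K).indicator fun _ ↦ 2 * K * W)
      (volume.restrict (Set.Ioi x)) :=
    ((integrable_indicator_iff measurableSet_Ioc).2 (integrableOn_const (by simp))).integrableOn
  calc _ ≤ ∫ w in Set.Ioi x, (Set.Ioc x K).indicator (fun _ ↦ 2 * K * W) w := by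
        refine integral_mono_of_nonneg (.of_forall fun w ↦ integral_div_cosh_nonneg hf w) hdom ?_
        refine (ae_restrict_mem measurableSet_Ioi).mono fun w hw ↦ ?_
        dsimp only
        by_cases hwK : w ≤ K
        · rw [Set.indicator_of_mem (s := Set.Ioc x K) ⟨hw, hwK⟩]
          exact integral_div_cosh_le hK hf hfW (fun z hz ↦ (hsupp z hz).2) w
        · rw [integral_div_cosh_eq_zero (fun z hz ↦ (hsupp z hz).1) (not_le.1 hwK)]
          rw [Set.indicator_of_notMem fun h ↦ hwK h.2]
    _ = 2 * K * W * max (K - x) 0 := by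
        rw [setIntegral_indicator measurableSet_Ioc,
          Set.inter_eq_self_of_subset_right fun w hw ↦ hw.1, setIntegral_const]
        simp [measureReal_def, ENNReal.toReal_ofReal', mul_comm]

theorem setIntegral_Ioi_integral_div_cosh_le (hK : 0 ≤ K) (hf : ∀ z, 0 ≤ f z)
    (hfW : ∀ z, f z ≤ W)
    (hsupp : ∀ z : ℝ × ℝ, f z ≠ 0 → z.1 ≤ K ∧ |z.2 - (z.1 + p z.1)| ≤ K) {x : ℝ}
    (hx : 0 ≤ p x) (hp : ∀ w, x < w → p w ≤ p x) :
    ∫ w in Set.Ioi x, ∫ z, f (w, z) / cosh z ≤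
      (4 * K * exp K + 2 * K ^ 2 + 2 * K) * W * (1 + p x) := by
  have hW : 0 ≤ W := (hf (0, 0)).trans (hfW _)
  set a := 4 * K * exp K * W with ha
  have ha0 : 0 ≤ a := by positivity
  set g₁ : ℝ → ℝ := (Set.Iic (-p x)).indicator fun w ↦ a * exp (p x) * exp w with hg₁
  set g₂ : ℝ → ℝ := (Set.Ioc (-p x) K).indicator fun _ ↦ 2 * K * W with hg₂
  have hi₁ : Integrable g₁ :=
    (integrable_indicator_iff measurableSet_Iic).2 ((integrableOn_exp_Iic _).const_mul _)
  have hi₂ : Integrable g₂ :=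
    (integrable_indicator_iff measurableSet_Ioc).2 (integrableOn_const (by simp))
  have h₁ : ∀ w, 0 ≤ g₁ w := Set.indicator_nonneg fun w _ ↦ by positivity
  have h₂ : ∀ w, 0 ≤ g₂ w := Set.indicator_nonneg fun w _ ↦ by positivity
  have he₁ : ∫ w, g₁ w = a := by
    rw [hg₁, integral_indicator measurableSet_Iic, integral_const_mul, integral_exp_Iic, mul_assoc,
      ← exp_add]
    simp
  have he₂ : ∫ w, g₂ w = 2 * K * W * (K + p x) := by
    rw [hg₂, integral_indicator measurableSet_Ioc, setIntegral_const, measureReal_def,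
      Real.volume_Ioc, ENNReal.toReal_ofReal (by linarith), smul_eq_mul]
    ring
  calc _ ≤ ∫ w in Set.Ioi x, (g₁ w + g₂ w) := by
        refine integral_mono_of_nonneg (.of_forall fun w ↦ integral_div_cosh_nonneg hf w)
          (hi₁.add hi₂).integrableOn ?_
        refine (ae_restrict_mem measurableSet_Ioi).mono fun w hw ↦ ?_
        dsimp only
        rcases le_or_gt w (-p x) with hwp | hwp
        · have hle : g₁ w = a * exp (p x) * exp w := Set.indicator_of_mem (s := Set.Iic (-p x)) hwp _
          have hb := integral_div_cosh_le_exp hK hf hfW (fun z hz ↦ (hsupp z hz).2) w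
          have hexp : exp (w + p w) ≤ exp (p x) * exp w := by
            rw [← exp_add]
            exact exp_le_exp.2 (by linarith [hp w hw])
          have := mul_le_mul_of_nonneg_left hexp ha0
          have := h₂ w
          rw [hle]
          linarith
        · rcases le_or_gt w K with hwK | hwK
          · have hle : g₂ w = 2 * K * W := Set.indicator_of_mem (s := Set.Ioc (-p x) K) ⟨hwp, hwK⟩ _
            have hb := integral_div_cosh_le hK hf hfW (fun z hz ↦ (hsupp z hz).2) w
            have := h₁ w
            linarith
          · rw [integral_div_cosh_eq_zero (fun z hz ↦ (hsupp z hz).1) hwK]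
            exact add_nonneg (h₁ w) (h₂ w)
    _ ≤ ∫ w, (g₁ w + g₂ w) :=
        setIntegral_le_integral (hi₁.add hi₂) (.of_forall fun w ↦ add_nonneg (h₁ w) (h₂ w))
    _ = a + 2 * K * W * (K + p x) := by rw [integral_add hi₁ hi₂, he₁, he₂]
    _ ≤ _ := by
        have e1 : 0 ≤ a * p x := mul_nonneg ha0 hx
        have e2 : 0 ≤ 2 * K ^ 2 * W * p x := by positivity
        have e3 : 0 ≤ 2 * K * W := by positivity
        nlinarith

end Slice

/-- A priori bound on the phase: there is `C > 0`, depending only on `K`, such that any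
bounded continuous solution `(ω, Φ)` of the hyperbolic Boussinesq system in
`z`-coordinates on `[0,T]` satisfies
`|Φ(z₁,t)| ≤ exp(C ∫₀ᵗ (1 + sup_z |ω(z,s)|) ds) - 1`. -/
theorem stmt_5 (K : ℝ) (hK : 0 < K) :
    ∃ C : ℝ, 0 < C ∧
      ∀ (T : ℝ) (ω₀ ρ₀ : ℝ × ℝ → ℝ) (ω : ℝ × ℝ → ℝ → ℝ) (Φ : ℝ → ℝ → ℝ),
        0 ≤ T →
        Measurable ω₀ → Measurable ρ₀ →
        (∃ M, ∀ z, |ω₀ z| ≤ M) → (∃ M, ∀ z, |ρ₀ z| ≤ M) →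
        (∀ z, 0 ≤ ω₀ z) → (∀ z, 0 ≤ ρ₀ z) →
        (∀ z : ℝ × ℝ, ω₀ z ≠ 0 → |z.1 - z.2| ≤ K ∧ z.1 + z.2 ≤ K) →
        (∀ z : ℝ × ℝ, ρ₀ z ≠ 0 → |z.1 - z.2| ≤ K ∧ z.1 + z.2 ≤ K) →
        (∃ M, ∀ z : ℝ × ℝ, ∀ t ∈ Set.Icc (0:ℝ) T, |ω z t| ≤ M) →
        (∃ M, ∀ z₁ : ℝ, ∀ t ∈ Set.Icc (0:ℝ) T, |Φ z₁ t| ≤ M) →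
        ContinuousOn (fun p : (ℝ × ℝ) × ℝ => ω p.1 p.2)
          (Set.univ ×ˢ Set.Icc (0:ℝ) T) →
        ContinuousOn (fun p : ℝ × ℝ => Φ p.1 p.2)
          (Set.univ ×ˢ Set.Icc (0:ℝ) T) →
        (∀ z : ℝ × ℝ, ∀ t ∈ Set.Icc (0:ℝ) T,
          ω z t = ω₀ (z.1, z.2 - Φ z.1 t) +
            Real.exp ((z.2 - Φ z.1 t - z.1) / 2) * ρ₀ (z.1, z.2 - Φ z.1 t) *
              ∫ s in (0:ℝ)..t, Real.exp (Φ z.1 s / 2)) →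
        (∀ z₁ : ℝ, ∀ t ∈ Set.Icc (0:ℝ) T,
          Φ z₁ t = (1 / 2) * ∫ s in (0:ℝ)..t, ∫ w in Set.Ioi z₁, ∫ z₂ : ℝ,
            ω (w, z₂) s / Real.cosh z₂) →
        ∀ t ∈ Set.Icc (0:ℝ) T, ∀ z₁ : ℝ,
          |Φ z₁ t| ≤
            Real.exp (C * ∫ s in (0:ℝ)..t, (1 + ⨆ z : ℝ × ℝ, |ω z s|)) - 1 := by
  set c := 4 * K * exp K + 2 * K ^ 2 + 2 * K with hc
  have hc0 : 0 < c := by positivity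
  refine ⟨c, hc0, ?_⟩
  intro T ω₀ ρ₀ ω Φ hT _ _ _ _ hω₀ hρ₀ hsω hsρ ⟨M, hM⟩ _ hωc _ hω hΦ
  have hM0 : 0 ≤ M := (abs_nonneg _).trans (hM 0 0 ⟨le_rfl, hT⟩)
  have hnn : ∀ t ∈ Set.Icc 0 T, ∀ z, 0 ≤ ω z t := by
    intro t ht z
    rw [hω z t ht]
    have h := intervalIntegral.integral_nonneg (μ := volume) ht.1
      (fun s _ ↦ (exp_pos (Φ z.1 s / 2)).le)
    exact add_nonneg (hω₀ _) (mul_nonneg (mul_nonneg (exp_pos _).le (hρ₀ _)) h)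
  have hsupp : ∀ t ∈ Set.Icc 0 T, ∀ z : ℝ × ℝ, ω z t ≠ 0 →
      z.1 ≤ K ∧ |z.2 - (z.1 + Φ z.1 t)| ≤ K := by
    intro t ht z hz
    have h : |z.1 - (z.2 - Φ z.1 t)| ≤ K ∧ z.1 + (z.2 - Φ z.1 t) ≤ K := by
      by_cases h1 : ω₀ (z.1, z.2 - Φ z.1 t) = 0
      · refine hsρ (z.1, z.2 - Φ z.1 t) fun h2 ↦ hz ?_
        rw [hω z t ht, h1, h2]
        simp
      · exact hsω (z.1, z.2 - Φ z.1 t) h1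
    refine ⟨by linarith [(abs_le.1 h.1).2], ?_⟩
    rw [abs_sub_comm]
    convert h.1 using 2
    ring
  have hleM : ∀ t ∈ Set.Icc 0 T, ∀ z, ω z t ≤ M := fun t ht z ↦ (le_abs_self _).trans (hM z t ht)
  set W : ℝ → ℝ := fun s ↦ ⨆ z : ℝ × ℝ, |ω z s| with hW
  have hleW : ∀ t ∈ Set.Icc 0 T, ∀ z, ω z t ≤ W t := fun t ht z ↦ (le_abs_self _).trans
    (le_ciSup (f := fun z ↦ |ω z t|) ⟨M, by rintro _ ⟨z, rfl⟩; exact hM z t ht⟩ z)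
  have hW0 : ∀ s, 0 ≤ W s := fun s ↦ Real.iSup_nonneg fun z ↦ abs_nonneg _
  have hWM : ∀ s ∈ Set.Icc 0 T, W s ≤ M := fun s hs ↦ ciSup_le fun z ↦ hM z s hs
  set v : ℝ × ℝ → ℝ → ℝ := fun z s ↦ ω z (Set.projIcc 0 T hT s) with hv
  have hvω : ∀ s ∈ Set.Icc 0 T, ∀ z, v z s = ω z s := fun s hs z ↦ by
    simp only [hv, Set.projIcc_of_mem hT hs]
  have hvc : Continuous fun q : (ℝ × ℝ) × ℝ ↦ v q.1 q.2 :=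
    hωc.comp_continuous
      (f := fun q : (ℝ × ℝ) × ℝ ↦ (q.1, ((Set.projIcc 0 T hT q.2 : Set.Icc 0 T) : ℝ)))
      (continuous_fst.prodMk
        (continuous_subtype_val.comp (continuous_projIcc.comp continuous_snd)))
      fun q ↦ ⟨trivial, (Set.projIcc 0 T hT q.2).2⟩
  have hslice : ∀ s ∈ Set.Icc 0 T, Continuous fun z ↦ ω z s := fun s hs ↦ by
    have h : Continuous fun z ↦ v z s := hvc.comp (continuous_id.prodMk continuous_const)
    simpa only [hvω s hs] using h
  have hWi : IntegrableOn W (Set.Icc 0 T) := by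
    have hm : Measurable fun s ↦ ⨆ z, |v z s| := by
      refine LowerSemicontinuous.measurable (lowerSemicontinuous_ciSup
        (fun s ↦ ⟨M, ?_⟩) fun z ↦ ?_)
      · rintro _ ⟨z, rfl⟩
        exact hM z _ (Set.projIcc 0 T hT s).2
      · exact (hvc.comp (continuous_const.prodMk continuous_id)).abs.lowerSemicontinuous
    have hi : IntegrableOn (fun s ↦ ⨆ z, |v z s|) (Set.Icc 0 T) := by
      refine Measure.integrableOn_of_bounded (M := M) (by simp) hm.aestronglyMeasurable ?_
      refine .of_forall fun s ↦ ?_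
      rw [norm_of_nonneg (Real.iSup_nonneg fun z ↦ abs_nonneg _)]
      exact ciSup_le fun z ↦ hM z _ (Set.projIcc 0 T hT s).2
    refine hi.congr_fun (fun s hs ↦ ?_) measurableSet_Icc
    simp only [hW, hvω s hs]
  set A : ℝ → ℝ → ℝ := fun x s ↦ ∫ w in Set.Ioi x, ∫ z, ω (w, z) s / cosh z with hA
  have hA0 : ∀ x, ∀ s ∈ Set.Icc 0 T, 0 ≤ A x s := fun x s hs ↦
    integral_nonneg fun w ↦ integral_div_cosh_nonneg (hnn s hs) w
  have hAi : ∀ x, IntegrableOn (A x) (Set.Icc 0 T) := by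
    intro x
    have hm₁ : StronglyMeasurable fun q : ℝ × ℝ ↦ ∫ z, v (q.2, z) q.1 / cosh z := by
      refine StronglyMeasurable.integral_prod_right
        (f := fun (q : ℝ × ℝ) z ↦ v (q.2, z) q.1 / cosh z) (Continuous.stronglyMeasurable ?_)
      refine Continuous.div ?_ (by fun_prop) fun q ↦ (cosh_pos _).ne'
      exact hvc.comp (g := fun q : (ℝ × ℝ) × ℝ ↦ v q.1 q.2)
        (f := fun q : (ℝ × ℝ) × ℝ ↦ ((q.1.2, q.2), q.1.1)) (by fun_prop)
    have hm : StronglyMeasurable fun s ↦ ∫ w in Set.Ioi x, ∫ z, v (w, z) s / cosh z :=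
      StronglyMeasurable.integral_prod_right (ν := volume.restrict (Set.Ioi x))
        (f := fun s w ↦ ∫ z, v (w, z) s / cosh z) hm₁
    have hi : IntegrableOn (fun s ↦ ∫ w in Set.Ioi x, ∫ z, v (w, z) s / cosh z)
        (Set.Icc 0 T) := by
      refine Measure.integrableOn_of_bounded (M := 2 * K * M * max (K - x) 0) (by simp)
        hm.aestronglyMeasurable (.of_forall fun s ↦ ?_)
      have hs := (Set.projIcc 0 T hT s).2
      rw [norm_of_nonneg (hA0 x _ hs)]
      exact setIntegral_Ioi_integral_div_cosh_le_const
        (p := fun w ↦ Φ w (Set.projIcc 0 T hT s)) hK.le (hnn _ hs) (hleM _ hs) (hsupp _ hs) x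
    refine hi.congr_fun (fun s hs ↦ ?_) measurableSet_Icc
    simp only [hA, hvω s hs]
  have hsub : ∀ {s t : ℝ}, 0 ≤ s → s ≤ t → t ≤ T → Set.uIcc s t ⊆ Set.Icc 0 T :=
    fun h0 hst ht ↦ by rw [Set.uIcc_of_le hst]; exact Set.Icc_subset_Icc h0 ht
  have hii : ∀ {g : ℝ → ℝ}, IntegrableOn g (Set.Icc 0 T) → ∀ {s t : ℝ}, 0 ≤ s → s ≤ t → t ≤ T →
      IntervalIntegrable g volume s t := fun hg _ _ h0 hst ht ↦
    (hg.mono_set (hsub h0 hst ht)).intervalIntegrable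
  have hΦ0 : ∀ x, ∀ t ∈ Set.Icc 0 T, 0 ≤ Φ x t := fun x t ht ↦ by
    rw [hΦ x t ht]
    exact mul_nonneg (by norm_num)
      (intervalIntegral.integral_nonneg ht.1 fun s hs ↦ hA0 x s ⟨hs.1, hs.2.trans ht.2⟩)
  have hanti : ∀ t ∈ Set.Icc 0 T, ∀ x w, x < w → Φ w t ≤ Φ x t := by
    intro t ht x w hxw
    rw [hΦ x t ht, hΦ w t ht]
    refine mul_le_mul_of_nonneg_left (intervalIntegral.integral_mono_on ht.1
      (hii (hAi w) le_rfl ht.1 ht.2) (hii (hAi x) le_rfl ht.1 ht.2) fun s hs ↦ ?_) (by norm_num)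
    have hs' : s ∈ Set.Icc 0 T := ⟨hs.1, hs.2.trans ht.2⟩
    exact setIntegral_mono_set
      (integrableOn_integral_div_cosh (p := fun w ↦ Φ w s) hK.le (hslice s hs') (hnn s hs')
        (hleM s hs') (hsupp s hs') x)
      (.of_forall fun y ↦ integral_div_cosh_nonneg (hnn s hs') y)
      (Set.Ioi_subset_Ioi hxw.le).eventuallyLE
  have hAle : ∀ x, ∀ s ∈ Set.Icc 0 T, A x s ≤ c * W s * (1 + Φ x s) := fun x s hs ↦
    setIntegral_Ioi_integral_div_cosh_le (p := fun w ↦ Φ w s) hK.le (hnn s hs) (hleW s hs)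
      (hsupp s hs) (hΦ0 x s hs) (hanti s hs x)
  have hinc : ∀ x s t, 0 ≤ s → s ≤ t → t ≤ T → Φ x t - Φ x s = 1 / 2 * ∫ r in s..t, A x r := by
    intro x s t h0 hst ht
    rw [hΦ x t ⟨h0.trans hst, ht⟩, hΦ x s ⟨h0, hst.trans ht⟩, ← mul_sub,
      intervalIntegral.integral_interval_sub_left (hii (hAi x) le_rfl (h0.trans hst) ht)
        (hii (hAi x) le_rfl h0 (hst.trans ht))]
  have hmono : ∀ x s t, 0 ≤ s → s ≤ t → t ≤ T → Φ x s ≤ Φ x t := by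
    intro x s t h0 hst ht
    have h := intervalIntegral.integral_nonneg (μ := volume) hst
      fun r hr ↦ hA0 x r ⟨h0.trans hr.1, hr.2.trans ht⟩
    linarith [hinc x s t h0 hst ht]
  have hW1 : IntegrableOn (fun s ↦ 1 + W s) (Set.Icc 0 T) :=
    Integrable.add (integrableOn_const (by simp)) hWi
  set k : ℝ → ℝ := fun t ↦ c / 2 * ∫ s in (0 : ℝ)..t, (1 + W s) with hk
  have hkinc : ∀ s t, 0 ≤ s → s ≤ t → t ≤ T → k t - k s = c / 2 * ∫ r in s..t, (1 + W r) := by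
    intro s t h0 hst ht
    simp only [hk]
    rw [← mul_sub, intervalIntegral.integral_interval_sub_left
      (hii hW1 le_rfl (h0.trans hst) ht) (hii hW1 le_rfl h0 (hst.trans ht))]
  intro t ht x
  have hG := le_mul_exp_of_sub_le_mul_sub (u := fun t ↦ 1 + Φ x t) (k := k) (T := T)
    (L := c / 2 * (1 + M)) (fun t ht ↦ by linarith [hΦ0 x t ht]) ?_ ?_ ?_ ht
  · have hzero : Φ x 0 = 0 := by simp [hΦ x 0 ⟨le_rfl, hT⟩]
    have hk0 : k 0 = 0 := by simp [hk]
    simp only [hzero, hk0, sub_zero, add_zero, one_mul] at hG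
    have he : 2 * k t = c * ∫ s in (0 : ℝ)..t, (1 + W s) := by simp only [hk]; ring
    rw [he] at hG
    rw [abs_of_nonneg (hΦ0 x t ht)]
    linarith
  · intro s t h0 hst ht
    have hle : ∫ r in s..t, A x r ≤ ∫ r in s..t, (c * (1 + Φ x t)) * (1 + W r) := by
      refine intervalIntegral.integral_mono_on hst (hii (hAi x) h0 hst ht)
        ((hii hW1 h0 hst ht).const_mul _) fun r hr ↦ ?_
      have hr' : r ∈ Set.Icc 0 T := ⟨h0.trans hr.1, hr.2.trans ht⟩
      have h1 : 0 ≤ Φ x r := hΦ0 x r hr'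
      have h2 := hmono x r t hr'.1 hr.2 ht
      calc A x r ≤ c * W r * (1 + Φ x r) := hAle x r hr'
        _ ≤ c * (1 + W r) * (1 + Φ x t) := by
            have := hW0 r
            gcongr
            linarith
        _ = _ := by ring
    rw [intervalIntegral.integral_const_mul] at hle
    have h1 := hinc x s t h0 hst ht
    rw [hkinc s t h0 hst ht]
    linarith
  · intro s t h0 hst ht
    rw [hkinc s t h0 hst ht, mul_assoc]
    refine mul_le_mul_of_nonneg_left ?_ (by positivity)
    calc ∫ r in s..t, (1 + W r) ≤ ∫ _ in s..t, (1 + M) :=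
          intervalIntegral.integral_mono_on hst (hii hW1 h0 hst ht) (by simp) fun r hr ↦ by
            linarith [hWM r ⟨h0.trans hr.1, hr.2.trans ht⟩]
      _ = (1 + M) * (t - s) := by
        rw [intervalIntegral.integral_const, smul_eq_mul, mul_comm]
  · intro s t h0 hst ht
    have h := intervalIntegral.integral_nonneg (μ := volume) hst
      fun r _ ↦ add_nonneg zero_le_one (hW0 r)
    have := mul_nonneg (half_pos hc0).le h
    linarith [hkinc s t h0 hst ht]
end

section
/- If T < ∞ and sup_{t<T} ∫₀ᵗ sup_z |ω(z,s)| ds < ∞, then sup_{z₁ ∈ ℝ, t < T} |Φ(z₁,t)| < ∞ and sup_{z ∈ ℝ², t < T} |ω(z,t)| < ∞. (Equivalently: at a maximal finite time of existence T of a regular solution of the hyperbolic Boussinesq system one must have ∫₀ᵗ ‖ω(·,s)‖_{L^∞} ds → ∞ as t → T.) -/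
open MeasureTheory Real

/-- Spatial bound for a nonnegative function concentrated in a strip of width `2K` around the
translated diagonal `z₂ = w + φ w`, with `0 ≤ φ ≤ m`, and vanishing for `w > K`. -/
theorem integral_strip_div_cosh_le {K m A z₁ : ℝ} (hK : 0 < K) (hm : 0 ≤ m) (hA : 0 ≤ A)
    {f : ℝ × ℝ → ℝ} {φ : ℝ → ℝ} (hf0 : ∀ z, 0 ≤ f z) (hfA : ∀ z, f z ≤ A)
    (hφm : ∀ w, φ w ≤ m)
    (hfs : ∀ z : ℝ × ℝ, f z ≠ 0 → |z.1 - (z.2 - φ z.1)| ≤ K ∧ z.1 + (z.2 - φ z.1) ≤ K) :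
    ∫ w in Set.Ioi z₁, ∫ z₂ : ℝ, f (w, z₂) / cosh z₂ ≤
      2 * K * A * (m + K + 2 * exp K) := by
  have hinner0 : ∀ w, 0 ≤ ∫ z₂ : ℝ, f (w, z₂) / cosh z₂ := fun w =>
    integral_nonneg fun z₂ => div_nonneg (hf0 _) (cosh_pos _).le
  have hinner : ∀ w b : ℝ, 0 ≤ b →
      (∀ z₂, f (w, z₂) ≠ 0 → 1 / cosh z₂ ≤ b) →
      ∫ z₂ : ℝ, f (w, z₂) / cosh z₂ ≤ 2 * K * A * b := by
    intro w b hb hcosh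
    have hle : ∫ z₂ : ℝ, f (w, z₂) / cosh z₂ ≤
        ∫ z₂ : ℝ, (Set.Icc (w + φ w - K) (w + φ w + K)).indicator (fun _ => A * b) z₂ := by
      refine integral_mono_of_nonneg
        (Filter.Eventually.of_forall fun z₂ => div_nonneg (hf0 _) (cosh_pos _).le) ?_
        (Filter.Eventually.of_forall fun z₂ => ?_)
      · rw [integrable_indicator_iff measurableSet_Icc]
        exact integrableOn_const (by simp)
      · by_cases hz : f (w, z₂) = 0
        · simp only [hz, zero_div]
          exact Set.indicator_nonneg (fun _ _ => mul_nonneg hA hb) _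
        · have h1 := abs_le.1 (hfs _ hz).1
          simp only at h1
          rw [Set.indicator_of_mem (Set.mem_Icc.2 ⟨by linarith [h1.2], by linarith [h1.1]⟩)]
          calc f (w, z₂) / cosh z₂ = f (w, z₂) * (1 / cosh z₂) := by ring
            _ ≤ A * b := mul_le_mul (hfA _) (hcosh _ hz)
                (one_div_nonneg.2 (cosh_pos _).le) hA
    refine hle.trans (le_of_eq ?_)
    rw [integral_indicator measurableSet_Icc, setIntegral_const, measureReal_def, Real.volume_Icc,
      ENNReal.toReal_ofReal (by linarith), smul_eq_mul]
    ring
  set G : ℝ → ℝ := fun w => (Set.Icc (-m) K).indicator (fun _ => 2 * K * A) w +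
    (Set.Iic (-m)).indicator (fun w => 4 * K * A * exp (m + K) * exp w) w with hG
  have hi1 : Integrable ((Set.Icc (-m) K).indicator (fun _ : ℝ => 2 * K * A)) := by
    rw [integrable_indicator_iff measurableSet_Icc]
    exact integrableOn_const (by simp)
  have hi2 : Integrable
      ((Set.Iic (-m)).indicator (fun w => 4 * K * A * exp (m + K) * exp w)) := by
    rw [integrable_indicator_iff measurableSet_Iic]
    exact (integrableOn_exp_Iic _).const_mul _
  have hGi : Integrable G := hi1.add hi2
  have hKA : 0 ≤ K * A := by positivity
  have hG1 : ∀ w, 0 ≤ (Set.Icc (-m) K).indicator (fun _ : ℝ => 2 * K * A) w := fun w =>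
    Set.indicator_nonneg (fun _ _ => by positivity) _
  have hG2 : ∀ w, 0 ≤
      (Set.Iic (-m)).indicator (fun w => 4 * K * A * exp (m + K) * exp w) w := fun w =>
    Set.indicator_nonneg (fun _ _ => by positivity) _
  have hG0 : ∀ w, 0 ≤ G w := fun w => add_nonneg (hG1 w) (hG2 w)
  have hGle : ∀ w, ∫ z₂ : ℝ, f (w, z₂) / cosh z₂ ≤ G w := by
    intro w
    rcases le_or_gt w (-m) with hw | hw
    · have h := hinner w (2 * exp (m + K) * exp w) (by positivity) (by
        intro z₂ hz
        have h1 := abs_le.1 (hfs _ hz).1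
        simp only at h1
        have h2 : z₂ ≤ m + K + w := by linarith [h1.1, hφm w]
        rw [div_le_iff₀ (cosh_pos _), mul_assoc 2, ← exp_add, cosh_eq]
        have h3 : exp z₂ ≤ exp (m + K + w) := exp_le_exp.2 h2
        have h4 : exp z₂ * exp (-z₂) = 1 := by rw [← exp_add]; simp
        nlinarith [exp_pos z₂, exp_pos (-z₂), exp_pos (m + K + w)])
      have h3 : (Set.Iic (-m)).indicator (fun w => 4 * K * A * exp (m + K) * exp w) w =
          4 * K * A * exp (m + K) * exp w := Set.indicator_of_mem (Set.mem_Iic.2 hw) _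
      have := hG1 w
      simp only [hG, h3]
      linarith
    · rcases le_or_gt w K with hwK | hwK
      · have h := hinner w 1 zero_le_one fun z₂ _ =>
          (div_le_one (cosh_pos _)).2 (one_le_cosh _)
        have h3 : (Set.Icc (-m) K).indicator (fun _ : ℝ => 2 * K * A) w = 2 * K * A :=
          Set.indicator_of_mem (Set.mem_Icc.2 ⟨hw.le, hwK⟩) _
        have := hG2 w
        simp only [hG, h3]
        linarith
      · refine le_trans (le_of_eq ?_) (hG0 w)
        have : ∀ z₂, f (w, z₂) = 0 := by
          intro z₂
          by_contra hz
          have h1 := abs_le.1 (hfs _ hz).1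
          have h2 := (hfs _ hz).2
          simp only at h1 h2
          linarith [h1.2]
        simp [this]
  calc ∫ w in Set.Ioi z₁, ∫ z₂ : ℝ, f (w, z₂) / cosh z₂
      ≤ ∫ w in Set.Ioi z₁, G w := integral_mono_of_nonneg
        (Filter.Eventually.of_forall hinner0) hGi.integrableOn (Filter.Eventually.of_forall hGle)
    _ ≤ ∫ w, G w := setIntegral_le_integral hGi (Filter.Eventually.of_forall hG0)
    _ = 2 * K * A * (m + K + 2 * exp K) := by
      rw [integral_add hi1 hi2, integral_indicator measurableSet_Icc, setIntegral_const,
        measureReal_def, Real.volume_Icc, ENNReal.toReal_ofReal (by linarith), smul_eq_mul,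
        integral_indicator measurableSet_Iic, integral_const_mul, integral_exp_Iic]
      have : exp (m + K) * exp (-m) = exp K := by rw [← exp_add]; congr 1; ring
      linear_combination 4 * K * A * this

/-- Freezing the time variable outside `[0, t]` makes a function continuous on `X × [0, T)`
continuous everywhere. -/
theorem continuous_comp_projIcc {X : Type*} [TopologicalSpace X] {T t : ℝ} (ht0 : 0 ≤ t)
    (htT : t < T) {f : X → ℝ → ℝ}
    (hf : ContinuousOn (fun p : X × ℝ => f p.1 p.2) (Set.univ ×ˢ Set.Ico (0 : ℝ) T)) :
    Continuous fun p : X × ℝ => f p.1 (Set.projIcc 0 t ht0 p.2) := by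
  refine hf.comp_continuous (f := fun p : X × ℝ => (p.1, (Set.projIcc 0 t ht0 p.2 : ℝ)))
    (continuous_fst.prodMk
      (continuous_subtype_val.comp (continuous_projIcc.comp continuous_snd))) fun p => ?_
  have h := (Set.projIcc 0 t ht0 p.2).2
  exact ⟨trivial, h.1, h.2.trans_lt htT⟩

theorem intervalIntegrable_iSup_abs {X : Type*} [TopologicalSpace X] {T t : ℝ}
    (ht0 : 0 ≤ t) (htT : t < T) {f : X → ℝ → ℝ}
    (hf : ContinuousOn (fun p : X × ℝ => f p.1 p.2) (Set.univ ×ˢ Set.Ico (0 : ℝ) T))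
    {M : ℝ} (hM : ∀ x, ∀ s ∈ Set.Icc 0 t, |f x s| ≤ M) :
    IntervalIntegrable (fun s => ⨆ x, |f x s|) volume 0 t := by
  have hc := continuous_comp_projIcc ht0 htT hf
  have hmeas : Measurable fun s => ⨆ x, |f x (Set.projIcc 0 t ht0 s)| := by
    refine (lowerSemicontinuous_ciSup (fun s => ⟨M, ?_⟩) fun x => ?_).measurable
    · rintro _ ⟨x, rfl⟩
      exact hM x _ (Set.projIcc 0 t ht0 s).2
    · exact ((hc.comp (continuous_const.prodMk continuous_id)).abs).lowerSemicontinuous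
  have hint : IntervalIntegrable (fun s => ⨆ x, |f x (Set.projIcc 0 t ht0 s)|) volume 0 t := by
    refine (intervalIntegrable_const (c := max M 0)).mono_fun hmeas.aestronglyMeasurable
      (Filter.Eventually.of_forall fun s => ?_)
    simp only [norm_eq_abs]
    rw [abs_of_nonneg (Real.iSup_nonneg fun x => abs_nonneg _), abs_of_nonneg (le_max_right _ _)]
    exact Real.iSup_le (fun x => (hM x _ (Set.projIcc 0 t ht0 s).2).trans (le_max_left _ _))
      (le_max_right _ _)
  refine hint.congr fun s hs => ?_
  rw [Set.uIoc_of_le ht0] at hs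
  simp only [Set.projIcc_of_mem ht0 (Set.Ioc_subset_Icc_self hs)]

theorem intervalIntegrable_integral_div_cosh {T t C : ℝ}
    (ht0 : 0 ≤ t) (htT : t < T) {f : ℝ × ℝ → ℝ → ℝ} {z₁ : ℝ}
    (hf : ContinuousOn (fun p : (ℝ × ℝ) × ℝ => f p.1 p.2) (Set.univ ×ˢ Set.Ico (0 : ℝ) T))
    (hC : ∀ s ∈ Set.Icc 0 t, |∫ w in Set.Ioi z₁, ∫ z₂ : ℝ, f (w, z₂) s / cosh z₂| ≤ C) :
    IntervalIntegrable (fun s => ∫ w in Set.Ioi z₁, ∫ z₂ : ℝ, f (w, z₂) s / cosh z₂)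
      volume 0 t := by
  have hc := continuous_comp_projIcc ht0 htT hf
  have h1 : StronglyMeasurable fun p : (ℝ × ℝ) × ℝ =>
      f (p.1.2, p.2) (Set.projIcc 0 t ht0 p.1.1) / cosh p.2 := by
    refine Continuous.stronglyMeasurable (Continuous.div ?_ (by fun_prop)
      fun p => (cosh_pos _).ne')
    exact hc.comp (g := fun p : (ℝ × ℝ) × ℝ => f p.1 (Set.projIcc 0 t ht0 p.2))
      (f := fun p : (ℝ × ℝ) × ℝ => ((p.1.2, p.2), p.1.1)) (by fun_prop)
  have h2 : StronglyMeasurable fun p : ℝ × ℝ =>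
      ∫ z₂ : ℝ, f (p.2, z₂) (Set.projIcc 0 t ht0 p.1) / cosh z₂ := h1.integral_prod_right'
  have h3 : StronglyMeasurable fun s : ℝ => ∫ w in Set.Ioi z₁,
      ∫ z₂ : ℝ, f (w, z₂) (Set.projIcc 0 t ht0 s) / cosh z₂ := h2.integral_prod_right'
  have hint : IntervalIntegrable (fun s : ℝ => ∫ w in Set.Ioi z₁,
      ∫ z₂ : ℝ, f (w, z₂) (Set.projIcc 0 t ht0 s) / cosh z₂) volume 0 t := by
    refine (intervalIntegrable_const (c := C)).mono_fun h3.aestronglyMeasurable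
      (Filter.Eventually.of_forall fun s => ?_)
    simp only [norm_eq_abs]
    exact (hC _ (Set.projIcc 0 t ht0 s).2).trans (le_abs_self _)
  refine hint.congr fun s hs => ?_
  rw [Set.uIoc_of_le ht0] at hs
  simp only [Set.projIcc_of_mem ht0 (Set.Ioc_subset_Icc_self hs)]

/-- A nonnegative function on `[0, T)` whose integrals `∫₀ᵗ` stay bounded has arbitrarily small
integral over `[t₀, t]`, uniformly in `t`, once `t₀` is close to `T`. -/
theorem exists_forall_intervalIntegral_lt {T δ : ℝ} (hT : 0 < T) (hδ : 0 < δ) {g : ℝ → ℝ}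
    (hg : ∀ t ∈ Set.Ico 0 T, IntervalIntegrable g volume 0 t)
    (hb : ∃ M, ∀ t ∈ Set.Ico 0 T, ∫ s in (0 : ℝ)..t, g s ≤ M) :
    ∃ t₀ ∈ Set.Ico 0 T, ∀ t ∈ Set.Ico t₀ T, ∫ s in t₀..t, g s < δ := by
  obtain ⟨M, hM⟩ := hb
  set S := (fun t => ∫ s in (0 : ℝ)..t, g s) '' Set.Ico 0 T with hS
  have hbdd : BddAbove S := ⟨M, by rintro _ ⟨t, ht, rfl⟩; exact hM t ht⟩
  have hne : S.Nonempty := ⟨_, 0, ⟨le_rfl, hT⟩, rfl⟩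
  obtain ⟨_, ⟨t₀, ht₀, rfl⟩, hlt⟩ := exists_lt_of_lt_csSup hne (sub_lt_self (sSup S) hδ)
  refine ⟨t₀, ht₀, fun t ht => ?_⟩
  have htm : t ∈ Set.Ico 0 T := ⟨ht₀.1.trans ht.1, ht.2⟩
  have h1 := le_csSup hbdd ⟨t, htm, rfl⟩
  have h2 := intervalIntegral.integral_interval_sub_left (hg t htm) (hg t₀ ht₀)
  simp only at h1 hlt
  linarith

/-- Beale–Kato–Majda type regularity criterion for the hyperbolic Boussinesq system:
if `T < ∞` and `∫₀ᵗ sup_z |ω(z,s)| ds` stays bounded as `t → T⁻`, then both `Φ` and `ω`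
remain uniformly bounded on `[0,T)`. -/
theorem stmt_6 (K T : ℝ) (hK : 0 < K) (hT : 0 < T)
    (ω₀ ρ₀ : ℝ × ℝ → ℝ)
    (hω₀m : Measurable ω₀) (hρ₀m : Measurable ρ₀)
    (hω₀b : ∃ M, ∀ z, |ω₀ z| ≤ M) (hρ₀b : ∃ M, ∀ z, |ρ₀ z| ≤ M)
    (hω₀p : ∀ z, 0 ≤ ω₀ z) (hρ₀p : ∀ z, 0 ≤ ρ₀ z)
    (hω₀s : ∀ z : ℝ × ℝ, ω₀ z ≠ 0 → |z.1 - z.2| ≤ K ∧ z.1 + z.2 ≤ K)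
    (hρ₀s : ∀ z : ℝ × ℝ, ρ₀ z ≠ 0 → |z.1 - z.2| ≤ K ∧ z.1 + z.2 ≤ K)
    (ω : ℝ × ℝ → ℝ → ℝ) (Φ : ℝ → ℝ → ℝ)
    (hωc : ContinuousOn (fun p : (ℝ × ℝ) × ℝ => ω p.1 p.2)
      (Set.univ ×ˢ Set.Ico (0:ℝ) T))
    (hΦc : ContinuousOn (fun p : ℝ × ℝ => Φ p.1 p.2)
      (Set.univ ×ˢ Set.Ico (0:ℝ) T))
    (hωb : ∀ T' : ℝ, T' < T →
      ∃ M, ∀ z : ℝ × ℝ, ∀ t ∈ Set.Icc (0:ℝ) T', |ω z t| ≤ M)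
    (hΦb : ∀ T' : ℝ, T' < T →
      ∃ M, ∀ z₁ : ℝ, ∀ t ∈ Set.Icc (0:ℝ) T', |Φ z₁ t| ≤ M)
    (hωeq : ∀ z : ℝ × ℝ, ∀ t ∈ Set.Ico (0:ℝ) T,
      ω z t = ω₀ (z.1, z.2 - Φ z.1 t) +
        Real.exp ((z.2 - Φ z.1 t - z.1) / 2) * ρ₀ (z.1, z.2 - Φ z.1 t) *
          ∫ s in (0:ℝ)..t, Real.exp (Φ z.1 s / 2))
    (hΦeq : ∀ z₁ : ℝ, ∀ t ∈ Set.Ico (0:ℝ) T,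
      Φ z₁ t = (1 / 2) * ∫ s in (0:ℝ)..t, ∫ w in Set.Ioi z₁, ∫ z₂ : ℝ,
        ω (w, z₂) s / Real.cosh z₂)
    (hint : ∃ M, ∀ t ∈ Set.Ico (0:ℝ) T,
      (∫ s in (0:ℝ)..t, ⨆ z : ℝ × ℝ, |ω z s|) ≤ M) :
    (∃ M, ∀ z₁ : ℝ, ∀ t ∈ Set.Ico (0:ℝ) T, |Φ z₁ t| ≤ M) ∧
    (∃ M, ∀ z : ℝ × ℝ, ∀ t ∈ Set.Ico (0:ℝ) T, |ω z t| ≤ M) := by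
  obtain ⟨Mω, hMω⟩ := hω₀b
  obtain ⟨Mρ, hMρ⟩ := hρ₀b
  have hω0 : ∀ z, ∀ t ∈ Set.Ico (0:ℝ) T, 0 ≤ ω z t := by
    intro z t ht
    rw [hωeq z t ht]
    have h : 0 ≤ ∫ s in (0:ℝ)..t, exp (Φ z.1 s / 2) :=
      intervalIntegral.integral_nonneg ht.1 fun s _ => (exp_pos _).le
    exact add_nonneg (hω₀p _) (mul_nonneg (mul_nonneg (exp_pos _).le (hρ₀p _)) h)
  have hωs : ∀ t ∈ Set.Ico (0:ℝ) T, ∀ z : ℝ × ℝ, ω z t ≠ 0 →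
      |z.1 - (z.2 - Φ z.1 t)| ≤ K ∧ z.1 + (z.2 - Φ z.1 t) ≤ K := by
    intro t ht z hz
    by_cases h1 : ω₀ (z.1, z.2 - Φ z.1 t) = 0
    · by_cases h2 : ρ₀ (z.1, z.2 - Φ z.1 t) = 0
      · exact absurd (by rw [hωeq z t ht, h1, h2]; simp) hz
      · exact hρ₀s _ h2
    · exact hω₀s _ h1
  have hΦ0 : ∀ z₁, ∀ t ∈ Set.Ico (0:ℝ) T, 0 ≤ Φ z₁ t := by
    intro z₁ t ht
    rw [hΦeq z₁ t ht]
    refine mul_nonneg (by norm_num) (intervalIntegral.integral_nonneg ht.1 fun s hs => ?_)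
    exact integral_nonneg fun w => integral_nonneg fun z₂ =>
      div_nonneg (hω0 _ s ⟨hs.1, hs.2.trans_lt ht.2⟩) (cosh_pos _).le
  have hωsup : ∀ t ∈ Set.Ico (0:ℝ) T, ∀ z, ω z t ≤ ⨆ z : ℝ × ℝ, |ω z t| := by
    intro t ht z
    obtain ⟨M, hM⟩ := hωb t ht.2
    exact (le_abs_self _).trans (le_ciSup (f := fun z => |ω z t|)
      ⟨M, by rintro _ ⟨z, rfl⟩; exact hM z t ⟨ht.1, le_rfl⟩⟩ z)
  have hsup0 : ∀ t, 0 ≤ ⨆ z : ℝ × ℝ, |ω z t| := fun t => Real.iSup_nonneg fun z => abs_nonneg _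
  have hsupint : ∀ t ∈ Set.Ico (0:ℝ) T,
      IntervalIntegrable (fun s => ⨆ z : ℝ × ℝ, |ω z s|) volume 0 t := by
    intro t ht
    obtain ⟨M, hM⟩ := hωb t ht.2
    exact intervalIntegrable_iSup_abs ht.1 ht.2 hωc hM
  set C : ℝ := K * (1 + K + 2 * exp K) with hC
  have hCpos : 0 < C := by positivity
  have hspace : ∀ m, 0 ≤ m → ∀ s ∈ Set.Ico (0:ℝ) T, (∀ w, Φ w s ≤ m) → ∀ z₁,
      ∫ w in Set.Ioi z₁, ∫ z₂ : ℝ, ω (w, z₂) s / cosh z₂ ≤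
        2 * C * (1 + m) * ⨆ z : ℝ × ℝ, |ω z s| := by
    intro m hm s hs hΦm z₁
    refine (integral_strip_div_cosh_le hK hm (hsup0 s) (fun z => hω0 z s hs) (hωsup s hs) hΦm
      (hωs s hs)).trans ?_
    have h1 : m + K + 2 * exp K ≤ (1 + K + 2 * exp K) * (1 + m) := by
      nlinarith [mul_nonneg hK.le hm, mul_nonneg (exp_pos K).le hm]
    have h2 := mul_le_mul_of_nonneg_left h1
      (mul_nonneg (mul_nonneg zero_le_two hK.le) (hsup0 s))
    refine h2.trans (le_of_eq ?_)
    rw [hC]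
    ring
  obtain ⟨t₀, ht₀, hsmall⟩ := exists_forall_intervalIntegral_lt hT
    (show 0 < 1 / (2 * C) by positivity) hsupint hint
  obtain ⟨M₀, hM₀⟩ := hΦb t₀ ht₀.2
  have hM₀0 : 0 ≤ M₀ := (abs_nonneg _).trans (hM₀ 0 0 ⟨le_rfl, ht₀.1⟩)
  have hstep : ∀ t ∈ Set.Ico t₀ T, ∀ m, 0 ≤ m → (∀ z₁, ∀ s ∈ Set.Icc 0 t, Φ z₁ s ≤ m) →
      ∀ z₁, Φ z₁ t ≤ M₀ + (1 + m) / 2 := by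
    intro t ht m hm hΦm z₁
    have htm : t ∈ Set.Ico 0 T := ⟨ht₀.1.trans ht.1, ht.2⟩
    have hmem : ∀ s ∈ Set.Icc 0 t, s ∈ Set.Ico 0 T := fun s hs => ⟨hs.1, hs.2.trans_lt ht.2⟩
    obtain ⟨M, hM⟩ := hωb t ht.2
    have hgint : ∀ r ∈ Set.Icc 0 t, IntervalIntegrable
        (fun s => ∫ w in Set.Ioi z₁, ∫ z₂ : ℝ, ω (w, z₂) s / cosh z₂) volume 0 r := by
      intro r hr
      refine intervalIntegrable_integral_div_cosh (C := 2 * C * (1 + m) * M) hr.1 (hmem r hr).2 hωc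
        fun s hs => ?_
      have hst : s ∈ Set.Icc 0 t := ⟨hs.1, hs.2.trans hr.2⟩
      rw [abs_of_nonneg (integral_nonneg fun w => integral_nonneg fun z₂ =>
        div_nonneg (hω0 _ s (hmem s hst)) (cosh_pos _).le)]
      refine (hspace m hm s (hmem s hst) (fun w => hΦm w s hst) z₁).trans ?_
      exact mul_le_mul_of_nonneg_left (ciSup_le fun z => hM z s hst) (by positivity)
    have h0 : t₀ ∈ Set.Icc 0 t := ⟨ht₀.1, ht.1⟩
    have h1 : t ∈ Set.Icc 0 t := ⟨htm.1, le_rfl⟩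
    have hdiff := intervalIntegral.integral_interval_sub_left (hgint t h1) (hgint t₀ h0)
    have hmono : ∫ s in t₀..t, ∫ w in Set.Ioi z₁, ∫ z₂ : ℝ, ω (w, z₂) s / cosh z₂ ≤
        ∫ s in t₀..t, 2 * C * (1 + m) * ⨆ z : ℝ × ℝ, |ω z s| := by
      refine intervalIntegral.integral_mono_on ht.1 ((hgint t₀ h0).symm.trans (hgint t h1))
        (((hsupint t₀ ht₀).symm.trans (hsupint t htm)).const_mul _) fun s hs => ?_
      have hst : s ∈ Set.Icc 0 t := ⟨ht₀.1.trans hs.1, hs.2⟩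
      exact hspace m hm s (hmem s hst) (fun w => hΦm w s hst) z₁
    rw [intervalIntegral.integral_const_mul] at hmono
    have h2 : 2 * C * (1 + m) * ∫ s in t₀..t, ⨆ z : ℝ × ℝ, |ω z s| ≤
        2 * C * (1 + m) * (1 / (2 * C)) :=
      mul_le_mul_of_nonneg_left (hsmall t ht).le (by positivity)
    have h3 : 2 * C * (1 + m) * (1 / (2 * C)) = 1 + m := by field_simp
    have h4 := (le_abs_self _).trans (hM₀ z₁ t₀ ⟨ht₀.1, le_rfl⟩)
    have h5 := hΦeq z₁ t htm
    have h6 := hΦeq z₁ t₀ ht₀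
    linarith
  have hΦle : ∀ z₁, ∀ t ∈ Set.Ico (0:ℝ) T, Φ z₁ t ≤ 2 * M₀ + 1 := by
    intro z t ht
    rcases le_or_gt t t₀ with htt | htt
    · linarith [(le_abs_self _).trans (hM₀ z t ⟨ht.1, htt⟩)]
    set S := (fun p : ℝ × ℝ => Φ p.1 p.2) '' (Set.univ ×ˢ Set.Icc 0 t) with hS
    obtain ⟨B, hB⟩ := hΦb t ht.2
    have hbdd : BddAbove S :=
      ⟨B, by rintro _ ⟨p, hp, rfl⟩; exact (le_abs_self _).trans (hB p.1 p.2 hp.2)⟩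
    have hmemS : ∀ z₁, ∀ s ∈ Set.Icc 0 t, Φ z₁ s ≤ sSup S := fun z₁ s hs =>
      le_csSup hbdd ⟨(z₁, s), ⟨trivial, hs⟩, rfl⟩
    have htmem : t ∈ Set.Icc 0 t := ⟨ht.1, le_rfl⟩
    have hS0 : 0 ≤ sSup S := (hΦ0 z t ht).trans (hmemS z t htmem)
    have hSle : sSup S ≤ M₀ + (1 + sSup S) / 2 := by
      refine csSup_le ⟨_, (z, t), ⟨trivial, htmem⟩, rfl⟩ ?_
      rintro _ ⟨⟨z₁, s⟩, ⟨-, hs⟩, rfl⟩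
      rcases le_or_gt s t₀ with hst | hst
      · linarith [(le_abs_self _).trans (hM₀ z₁ s ⟨hs.1, hst⟩)]
      · exact hstep s ⟨hst.le, hs.2.trans_lt ht.2⟩ _ hS0
          (fun z₁ r hr => hmemS z₁ r ⟨hr.1, hr.2.trans hs.2⟩) z₁
    linarith [hmemS z t htmem]
  refine ⟨⟨2 * M₀ + 1, fun z₁ t ht => ?_⟩,
    ⟨Mω + exp (K / 2) * Mρ * (exp ((2 * M₀ + 1) / 2) * T), fun z t ht => ?_⟩⟩
  · rw [abs_of_nonneg (hΦ0 z₁ t ht)]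
    exact hΦle z₁ t ht
  · rw [abs_of_nonneg (hω0 z t ht), hωeq z t ht]
    have hMρ0 : 0 ≤ Mρ := (abs_nonneg _).trans (hMρ 0)
    have hI : ∫ s in (0:ℝ)..t, exp (Φ z.1 s / 2) ≤ exp ((2 * M₀ + 1) / 2) * T := by
      have h := intervalIntegral.norm_integral_le_of_norm_le_const
        (f := fun s => exp (Φ z.1 s / 2)) (a := 0) (b := t) (C := exp ((2 * M₀ + 1) / 2)) (by
          intro s hs
          rw [Set.uIoc_of_le ht.1] at hs
          rw [norm_eq_abs, abs_of_pos (exp_pos _), exp_le_exp]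
          linarith [hΦle z.1 s ⟨hs.1.le, hs.2.trans_lt ht.2⟩])
      rw [sub_zero, abs_of_nonneg ht.1] at h
      exact (le_abs_self _).trans (h.trans
        (mul_le_mul_of_nonneg_left ht.2.le (exp_pos _).le))
    have hI0 : 0 ≤ ∫ s in (0:ℝ)..t, exp (Φ z.1 s / 2) :=
      intervalIntegral.integral_nonneg ht.1 fun s _ => (exp_pos _).le
    refine add_le_add ((le_abs_self _).trans (hMω _)) (mul_le_mul ?_ hI hI0 (by positivity))
    by_cases h : ρ₀ (z.1, z.2 - Φ z.1 t) = 0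
    · rw [h, mul_zero]
      positivity
    · have h1 := (abs_le.1 (hρ₀s _ h).1).1
      simp only at h1
      exact mul_le_mul (exp_le_exp.2 (by linarith)) ((le_abs_self _).trans (hMρ _)) (hρ₀p _)
        (exp_pos _).le
end

section
/- There exist γ > 0 and t₀ ≥ 0, depending only on ω₀, such that sup_{z₁ ∈ ℝ} Φ(z₁,t) ≥ 2γ(t − t₀) for all t ≥ t₀. (Together with the uniform upper bound on Ω this shows the phase grows exactly linearly, so that exponential-in-time growth of the derivatives of the vorticity is realized in the original coordinates.) -/
open MeasureTheory Real

/-- `IsGlobalSolution ω₀ Φ`: `Φ` is a global solution of the hyperbolic 2D Euler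
equation in `z`-coordinates with data `ω₀`: it is continuous on `ℝ × [0,∞)`, bounded
on `ℝ × [0,T]` for every `T > 0`, and with `ω(z₁,z₂,t) := ω₀(z₁, z₂ - Φ(z₁,t))` it
satisfies `Φ(z₁,t) = (1/2)∫₀ᵗ ∫_{z₁}^∞ ∫_ℝ ω(z̃₁,z₂,s)/cosh(z₂) dz₂ dz̃₁ ds`. -/
def IsGlobalSolution (ω₀ : ℝ × ℝ → ℝ) (Φ : ℝ → ℝ → ℝ) : Prop :=
  ContinuousOn (fun p : ℝ × ℝ => Φ p.1 p.2) (Set.univ ×ˢ Set.Ici (0:ℝ)) ∧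
  (∀ T : ℝ, 0 < T → ∃ M, ∀ z₁ : ℝ, ∀ t ∈ Set.Icc (0:ℝ) T, |Φ z₁ t| ≤ M) ∧
  ∀ (z₁ t : ℝ), 0 ≤ t →
    Φ z₁ t = (1 / 2) * ∫ s in (0:ℝ)..t, ∫ w in Set.Ioi z₁, ∫ z₂ : ℝ,
      ω₀ (w, z₂ - Φ w s) / Real.cosh z₂

/-- The velocity amplitude
`Ω(z₁,t) = (1/4)∫_{z₁}^∞ ∫_ℝ ω₀(z̃₁, z₂ - Φ(z̃₁,t))/cosh(z₂) dz₂ dz̃₁`. -/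
noncomputable def Omeg (ω₀ : ℝ × ℝ → ℝ) (Φ : ℝ → ℝ → ℝ) (z₁ t : ℝ) : ℝ :=
  (1 / 4) * ∫ w in Set.Ioi z₁, ∫ z₂ : ℝ, ω₀ (w, z₂ - Φ w t) / Real.cosh z₂

/-- The integral of the datum against `1 / cosh` along a vertical line shifted by `φ`. -/
noncomputable def lineIntegral (ω₀ : ℝ × ℝ → ℝ) (w φ : ℝ) : ℝ :=
  ∫ z₂ : ℝ, ω₀ (w, z₂ - φ) / Real.cosh z₂

lemma inv_cosh_le_two_mul (x : ℝ) : 1 / Real.cosh x ≤ 2 * (1 + x ^ 2)⁻¹ := by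
  have h : 1 + x ^ 2 / 2 ≤ Real.cosh x := by
    have h1 : Real.cosh x = 1 + 2 * Real.sinh (x / 2) ^ 2 := by
      have h2 := Real.cosh_two_mul (x / 2)
      have h3 := Real.cosh_sq (x / 2)
      rw [show 2 * (x / 2) = x by ring] at h2
      linarith
    have h4 : |x / 2| ≤ |Real.sinh (x / 2)| := by
      rw [Real.abs_sinh]
      exact Real.self_le_sinh_iff.2 (abs_nonneg _)
    have h5 := sq_le_sq.2 h4
    linarith [h5, h1, (by ring : (x / 2) ^ 2 = x ^ 2 / 4)]
  rw [← div_eq_mul_inv, div_le_div_iff₀ (Real.cosh_pos x) (by positivity)]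
  nlinarith [sq_nonneg x]

lemma norm_div_cosh_le {ω₀ : ℝ × ℝ → ℝ} (hrange : ∀ z, 0 ≤ ω₀ z ∧ ω₀ z ≤ 1)
    (z : ℝ × ℝ) (x : ℝ) : ‖ω₀ z / Real.cosh x‖ ≤ 2 * (1 + x ^ 2)⁻¹ := by
  rw [Real.norm_of_nonneg (div_nonneg (hrange z).1 (Real.cosh_pos x).le)]
  refine le_trans ?_ (inv_cosh_le_two_mul x)
  gcongr
  · exact (hrange z).2

lemma continuous_lineIntegral {ω₀ : ℝ × ℝ → ℝ} (hω : Continuous ω₀)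
    (hrange : ∀ z, 0 ≤ ω₀ z ∧ ω₀ z ≤ 1) :
    Continuous (fun p : ℝ × ℝ => lineIntegral ω₀ p.1 p.2) := by
  refine continuous_of_dominated (bound := fun x : ℝ => 2 * (1 + x ^ 2)⁻¹) ?_ ?_ ?_ ?_
  · intro p
    refine Continuous.aestronglyMeasurable ?_
    exact (by fun_prop : Continuous fun x : ℝ => ω₀ (p.1, x - p.2)).div Real.continuous_cosh
      (fun x => (Real.cosh_pos x).ne')
  · exact fun p => Filter.Eventually.of_forall fun x => norm_div_cosh_le hrange _ x
  · exact integrable_inv_one_add_sq.const_mul 2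
  · refine Filter.Eventually.of_forall fun x => ?_
    exact (by fun_prop : Continuous fun p : ℝ × ℝ => ω₀ (p.1, x - p.2)).div_const _

lemma lineIntegral_nonneg {ω₀ : ℝ × ℝ → ℝ} (hrange : ∀ z, 0 ≤ ω₀ z ∧ ω₀ z ≤ 1)
    (w φ : ℝ) : 0 ≤ lineIntegral ω₀ w φ :=
  integral_nonneg fun x => div_nonneg (hrange _).1 (Real.cosh_pos x).le

lemma norm_lineIntegral_le {K : ℝ} {ω₀ : ℝ × ℝ → ℝ} (hrange : ∀ z, 0 ≤ ω₀ z ∧ ω₀ z ≤ 1)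
    (hsupp : ∀ z : ℝ × ℝ, ω₀ z ≠ 0 → |z.1 - z.2| ≤ K ∧ z.1 + z.2 ≤ K) (w φ : ℝ) :
    ‖lineIntegral ω₀ w φ‖ ≤
      (Set.Iic K).indicator (fun _ => ∫ x : ℝ, 2 * (1 + x ^ 2)⁻¹) w := by
  by_cases hw : w ≤ K
  · rw [Set.indicator_of_mem (Set.mem_Iic.2 hw)]
    exact norm_integral_le_of_norm_le (integrable_inv_one_add_sq.const_mul 2)
      (Filter.Eventually.of_forall fun x => norm_div_cosh_le hrange _ x)
  · have h0 : ∀ y, ω₀ (w, y) = 0 := by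
      intro y
      by_contra hne
      obtain ⟨h1, h2⟩ := hsupp _ hne
      have h3 := (abs_le.1 h1).2
      simp only at h2 h3
      linarith
    simp [lineIntegral, h0, Set.indicator, hw]

lemma integrable_indicator_Iic_Ioi (K C z : ℝ) :
    Integrable ((Set.Iic K).indicator fun _ => C) (volume.restrict (Set.Ioi z)) := by
  rw [integrable_indicator_iff measurableSet_Iic, IntegrableOn,
    Measure.restrict_restrict measurableSet_Iic]
  refine integrableOn_const (hs := ?_)
  rw [Set.inter_comm, Set.Ioi_inter_Iic]
  simp

lemma le_lineIntegral {K c R : ℝ} (hc : 0 < c) {ω₀ : ℝ × ℝ → ℝ} (hω : Continuous ω₀)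
    (hrange : ∀ z, 0 ≤ ω₀ z ∧ ω₀ z ≤ 1)
    (hsupp : ∀ z : ℝ × ℝ, ω₀ z ≠ 0 → |z.1 - z.2| ≤ K ∧ z.1 + z.2 ≤ K) {w φ : ℝ}
    (hlow : c ≤ ∫ y : ℝ, ω₀ (w, y)) (hR : |w + φ| + K ≤ R) :
    c / Real.cosh R ≤ lineIntegral ω₀ w φ := by
  have hint : Integrable fun y => ω₀ (w, y) := by
    by_contra h
    rw [integral_undef h] at hlow
    linarith
  calc c / Real.cosh R ≤ (∫ y : ℝ, ω₀ (w, y)) / Real.cosh R := by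
        gcongr
    _ = ∫ z : ℝ, ω₀ (w, z - φ) / Real.cosh R := by
        rw [integral_div, integral_sub_right_eq_self (fun y => ω₀ (w, y)) φ]
    _ ≤ lineIntegral ω₀ w φ := by
        refine integral_mono ((hint.comp_sub_right φ).div_const _) ?_ fun z => ?_
        · refine (integrable_inv_one_add_sq.const_mul 2).mono' ?_
            (Filter.Eventually.of_forall fun x => norm_div_cosh_le hrange _ x)
          refine Continuous.aestronglyMeasurable ?_
          exact (by fun_prop : Continuous fun x : ℝ => ω₀ (w, x - φ)).div Real.continuous_cosh
            (fun x => (Real.cosh_pos x).ne')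
        · by_cases h0 : ω₀ (w, z - φ) = 0
          · simp [h0]
          · have h1 := (hsupp _ h0).1
            simp only at h1
            refine div_le_div_of_nonneg_left (hrange _).1 (Real.cosh_pos z) ?_
            refine Real.cosh_le_cosh.2 (le_trans ?_ (le_abs_self R))
            have h2 := abs_sub (w + φ) (w - (z - φ))
            rw [show w + φ - (w - (z - φ)) = z by ring] at h2
            linarith

lemma IsGlobalSolution.continuous_slice {ω₀ : ℝ × ℝ → ℝ} {Φ : ℝ → ℝ → ℝ}
    (hΦ : IsGlobalSolution ω₀ Φ) {s : ℝ} (hs : 0 ≤ s) : Continuous fun w => Φ w s :=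
  hΦ.1.comp_continuous (f := fun w : ℝ => (w, s)) (by fun_prop) fun _ => ⟨trivial, hs⟩

lemma IsGlobalSolution.integrableOn_lineIntegral {K : ℝ} {ω₀ : ℝ × ℝ → ℝ} {Φ : ℝ → ℝ → ℝ}
    (hΦ : IsGlobalSolution ω₀ Φ) (hω : Continuous ω₀) (hrange : ∀ z, 0 ≤ ω₀ z ∧ ω₀ z ≤ 1)
    (hsupp : ∀ z : ℝ × ℝ, ω₀ z ≠ 0 → |z.1 - z.2| ≤ K ∧ z.1 + z.2 ≤ K) {s : ℝ} (hs : 0 ≤ s)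
    (z : ℝ) : IntegrableOn (fun w => lineIntegral ω₀ w (Φ w s)) (Set.Ioi z) :=
  (integrable_indicator_Iic_Ioi K _ z).mono'
    ((continuous_lineIntegral hω hrange).comp
      (continuous_id.prodMk (hΦ.continuous_slice hs))).aestronglyMeasurable
    (Filter.Eventually.of_forall fun _ => norm_lineIntegral_le hrange hsupp _ _)

lemma IsGlobalSolution.intervalIntegrable {K : ℝ} {ω₀ : ℝ × ℝ → ℝ} {Φ : ℝ → ℝ → ℝ}
    (hΦ : IsGlobalSolution ω₀ Φ) (hω : Continuous ω₀) (hrange : ∀ z, 0 ≤ ω₀ z ∧ ω₀ z ≤ 1)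
    (hsupp : ∀ z : ℝ × ℝ, ω₀ z ≠ 0 → |z.1 - z.2| ≤ K ∧ z.1 + z.2 ≤ K) {t : ℝ} (ht : 0 ≤ t)
    (z : ℝ) : IntervalIntegrable
      (fun s => ∫ w in Set.Ioi z, lineIntegral ω₀ w (Φ w s)) volume 0 t := by
  refine ContinuousOn.intervalIntegrable ?_
  rw [Set.uIcc_of_le ht]
  refine ContinuousOn.mono (s := Set.Ici 0) ?_ Set.Icc_subset_Ici_self
  refine continuousOn_of_dominated
    (bound := (Set.Iic K).indicator fun _ => ∫ x : ℝ, 2 * (1 + x ^ 2)⁻¹) ?_ ?_ ?_ ?_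
  · exact fun s hs =>
      (hΦ.integrableOn_lineIntegral hω hrange hsupp hs z).aestronglyMeasurable
  · exact fun s _ => Filter.Eventually.of_forall fun _ => norm_lineIntegral_le hrange hsupp _ _
  · exact integrable_indicator_Iic_Ioi K _ z
  · refine Filter.Eventually.of_forall fun w => ?_
    have hc : ContinuousOn (fun s => Φ w s) (Set.Ici 0) :=
      hΦ.1.comp (f := fun s : ℝ => (w, s)) (by fun_prop) fun _ hs => ⟨trivial, hs⟩
    exact (continuous_lineIntegral hω hrange).comp_continuousOn (continuousOn_const.prodMk hc)

lemma IsGlobalSolution.nonneg {ω₀ : ℝ × ℝ → ℝ} {Φ : ℝ → ℝ → ℝ}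
    (hΦ : IsGlobalSolution ω₀ Φ) (hrange : ∀ z, 0 ≤ ω₀ z ∧ ω₀ z ≤ 1) {t : ℝ} (ht : 0 ≤ t)
    (z : ℝ) : 0 ≤ Φ z t := by
  rw [hΦ.2.2 z t ht]
  refine mul_nonneg (by norm_num) (intervalIntegral.integral_nonneg ht fun s _ => ?_)
  exact integral_nonneg fun w => lineIntegral_nonneg hrange _ _

lemma IsGlobalSolution.antitone_slice {K : ℝ} {ω₀ : ℝ × ℝ → ℝ} {Φ : ℝ → ℝ → ℝ}
    (hΦ : IsGlobalSolution ω₀ Φ) (hω : Continuous ω₀) (hrange : ∀ z, 0 ≤ ω₀ z ∧ ω₀ z ≤ 1)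
    (hsupp : ∀ z : ℝ × ℝ, ω₀ z ≠ 0 → |z.1 - z.2| ≤ K ∧ z.1 + z.2 ≤ K) {t : ℝ} (ht : 0 ≤ t) :
    Antitone fun z => Φ z t := by
  intro z z' hz
  simp only
  rw [hΦ.2.2 z t ht, hΦ.2.2 z' t ht]
  refine mul_le_mul_of_nonneg_left ?_ (by norm_num)
  refine intervalIntegral.integral_mono_on ht
    (hΦ.intervalIntegrable hω hrange hsupp ht z')
    (hΦ.intervalIntegrable hω hrange hsupp ht z) fun s hs => ?_
  exact setIntegral_mono_set (hΦ.integrableOn_lineIntegral hω hrange hsupp hs.1 z)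
    (Filter.Eventually.of_forall fun w => lineIntegral_nonneg hrange _ _)
    (Set.Ioi_subset_Ioi hz).eventuallyLE

/-- The leftmost point where `w + Φ` reaches `Z₁` carries a unit interval to its left on which
`w + Φ` stays within distance one of `Z₁`, because `Φ` is nonincreasing in `w`. -/
lemma exists_unit_interval {f : ℝ → ℝ} (hf : Continuous f) (hanti : Antitone f)
    (hnonneg : ∀ w, 0 ≤ f w) {M : ℝ} (hM : ∀ w, f w ≤ M) (Z : ℝ) :
    ∃ a, Z - M ≤ a ∧ a ≤ Z ∧ ∀ w ∈ Set.Ioo (a - 1) a, |w + f w| ≤ |Z| + 1 := by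
  set S : Set ℝ := {w | w ≤ Z ∧ Z ≤ w + f w}
  have hclosed : IsClosed S :=
    (isClosed_le continuous_id continuous_const).inter
      (isClosed_le continuous_const (continuous_id.add hf))
  have hne : S.Nonempty := ⟨Z, le_rfl, by linarith [hnonneg Z]⟩
  have hlb : Z - M ∈ lowerBounds S := fun w hw => by linarith [hw.2, hM w]
  have hmem : sInf S ∈ S := hclosed.csInf_mem hne ⟨_, hlb⟩
  refine ⟨sInf S, hlb hmem, hmem.1, fun w hw => ?_⟩
  have h1 : w + f w < Z := by
    by_contra! h
    exact absurd (csInf_le ⟨_, hlb⟩ (show w ∈ S from ⟨hw.2.le.trans hmem.1, h⟩)) (not_le.2 hw.2)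
  have h2 : f (sInf S) ≤ f w := hanti hw.2.le
  have h3 : Z - 1 ≤ w + f w := by linarith [hmem.2, hw.1]
  rw [abs_le]
  constructor <;> linarith [le_abs_self Z, neg_abs_le Z]

/-- Linear lower bound on the phase of the hyperbolic 2D Euler equation: there are
`γ > 0` and `t₀ ≥ 0`, depending only on `ω₀`, with
`sup_{z₁} Φ(z₁,t) ≥ 2γ(t - t₀)` for all `t ≥ t₀`. -/
theorem stmt_9 (K Z₁ c : ℝ) (hK : 0 < K) (hc : 0 < c) (ω₀ : ℝ × ℝ → ℝ)
    (hC1 : ContDiff ℝ 1 ω₀)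
    (hrange : ∀ z, 0 ≤ ω₀ z ∧ ω₀ z ≤ 1)
    (hsupp : ∀ z : ℝ × ℝ, ω₀ z ≠ 0 → |z.1 - z.2| ≤ K ∧ z.1 + z.2 ≤ K)
    (hZ₁ : Z₁ < sSup {w : ℝ | ∃ z₂, ω₀ (w, z₂) ≠ 0})
    (hlow : ∀ w : ℝ, w ≤ Z₁ → c ≤ ∫ z₂ : ℝ, ω₀ (w, z₂)) :
    ∃ γ t₀ : ℝ, 0 < γ ∧ 0 ≤ t₀ ∧
      ∀ Φ : ℝ → ℝ → ℝ, IsGlobalSolution ω₀ Φ →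
        ∀ t : ℝ, t₀ ≤ t → 2 * γ * (t - t₀) ≤ ⨆ z₁ : ℝ, Φ z₁ t := by

  have hω := hC1.continuous
  set κ : ℝ := c / Real.cosh (|Z₁| + 1 + K) with hκ
  have hκ0 : 0 < κ := div_pos hc (Real.cosh_pos _)
  refine ⟨κ / 4, 0, by positivity, le_rfl, fun Φ hΦ t ht => ?_⟩
  obtain ⟨M, hM⟩ := hΦ.2.1 (t + 1) (by linarith)
  have hle : ∀ s ∈ Set.Icc 0 t, ∀ w, Φ w s ≤ M := fun s hs w =>
    (le_abs_self _).trans (hM w s ⟨hs.1, by linarith [hs.2]⟩)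
  have hrate : ∀ s ∈ Set.Icc 0 t,
      κ ≤ ∫ w in Set.Ioi (Z₁ - M - 1), lineIntegral ω₀ w (Φ w s) := by
    intro s hs
    obtain ⟨a, ha1, ha2, ha⟩ := exists_unit_interval (hΦ.continuous_slice hs.1)
      (hΦ.antitone_slice hω hrange hsupp hs.1) (hΦ.nonneg hrange hs.1) (hle s hs) Z₁
    have hint := hΦ.integrableOn_lineIntegral hω hrange hsupp hs.1 (Z₁ - M - 1)
    have hsub : Set.Ioo (a - 1) a ⊆ Set.Ioi (Z₁ - M - 1) := fun w hw => by
      have := hw.1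
      simp only [Set.mem_Ioi]
      linarith
    calc κ = ∫ _ in Set.Ioo (a - 1) a, κ := by simp
      _ ≤ ∫ w in Set.Ioo (a - 1) a, lineIntegral ω₀ w (Φ w s) := by
          refine setIntegral_mono_on (integrableOn_const (hs := by simp)) (hint.mono_set hsub)
            measurableSet_Ioo fun w hw => ?_
          exact le_lineIntegral hc hω hrange hsupp (hlow w (hw.2.le.trans ha2))
            (by linarith [ha w hw])
      _ ≤ _ := setIntegral_mono_set hint
          (Filter.Eventually.of_forall fun w => lineIntegral_nonneg hrange _ _)
          hsub.eventuallyLE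
  have hbdd : BddAbove (Set.range fun z => Φ z t) :=
    ⟨M, by rintro _ ⟨w, rfl⟩; exact hle t ⟨ht, le_rfl⟩ w⟩
  refine le_trans ?_ (le_ciSup hbdd (Z₁ - M - 1))
  rw [hΦ.2.2 _ t ht]
  have hmono := intervalIntegral.integral_mono_on ht intervalIntegrable_const
    (hΦ.intervalIntegrable hω hrange hsupp ht (Z₁ - M - 1)) hrate
  rw [intervalIntegral.integral_const, smul_eq_mul] at hmono
  simp only [lineIntegral] at hmono
  linarith
end
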